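/- arXiv:1403.4673 — 4 statements merged into one kernel-verified Lean document; each statement's English description precedes it below -/
import Mathlib

section
/- Let H be a Hopf algebra over k (not necessarily finite dimensional) generated by a finite group G = G(H) of grouplike elements together with a set of (g_i,1)-skew primitive elements x_i (g_i ∈ G), and assume that for each i the Hopf subalgebra generated by {g_i, x_i} is finite dimensional. Then: (i) A^H = A^G for any commutative domain A that is an H-module algebra; (ii) if H acts inner faithfully on a field L, then the field extension L^H = L^G ⊆ L is Galois with Galois group G. -/
open TensorProduct

/-- A grouplike element of a Hopf algebra. -/
def IsGrouplike (k : Type) {H : Type} [CommSemiring k] [Semiring H] [HopfAlgebra k H]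
    (g : H) : Prop :=
  g ≠ 0 ∧ Coalgebra.comul (R := k) g = g ⊗ₜ[k] g

/-- A Hopf ideal of a Hopf algebra `H` over `k`: a two-sided ideal which is also a coideal
and is stable under the antipode. -/
structure HopfIdeal (k H : Type) [CommSemiring k] [Semiring H] [HopfAlgebra k H] where
  carrier : Submodule k H
  mul_mem_left : ∀ (a : H) {x : H}, x ∈ carrier → a * x ∈ carrier
  mul_mem_right : ∀ (a : H) {x : H}, x ∈ carrier → x * a ∈ carrier
  comul_mem : ∀ x ∈ carrier, Coalgebra.comul (R := k) x ∈
      (LinearMap.range (TensorProduct.map carrier.subtype (LinearMap.id (M := H))) ⊔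
       LinearMap.range (TensorProduct.map (LinearMap.id (M := H)) carrier.subtype))
  counit_eq_zero : ∀ x ∈ carrier, Coalgebra.counit (R := k) x = 0
  antipode_mem : ∀ x ∈ carrier, HopfAlgebra.antipode (R := k) x ∈ carrier

/-- A (left) action of a Hopf algebra `H` on an algebra `A`, making `A` an `H`-module algebra:
`h ⬝ (a b) = ∑ (h₁ ⬝ a) (h₂ ⬝ b)` and `h ⬝ 1 = ε(h) 1`. -/
structure HopfAction (k H A : Type) [CommSemiring k] [Semiring H] [HopfAlgebra k H]
    [Semiring A] [Algebra k A] where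
  act : H →ₐ[k] Module.End k A
  act_mul : ∀ (h : H) (a b : A),
    act h (a * b) = LinearMap.mul' k A
      (TensorProduct.map ((act.toLinearMap : H →ₗ[k] A →ₗ[k] A).flip a)
        ((act.toLinearMap : H →ₗ[k] A →ₗ[k] A).flip b) (Coalgebra.comul (R := k) h))
  act_one : ∀ h : H, act h (1 : A) = Coalgebra.counit (R := k) h • (1 : A)

/-- A module over a Hopf algebra (given by its structure map `ρ`) is inner faithful if no
nonzero Hopf ideal annihilates it. -/
def InnerFaithful (k : Type) {H M : Type} [CommSemiring k] [Semiring H] [HopfAlgebra k H]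
    [AddCommMonoid M] [Module k M] (ρ : H →ₗ[k] Module.End k M) : Prop :=
  ∀ I : HopfIdeal k H, (∀ x ∈ I.carrier, ρ x = 0) → I.carrier = ⊥

/-- A witness that the Hopf algebra `H` is Galois-theoretical: a field `L ⊇ k` together with an
inner faithful `H`-module algebra structure on `L`. -/
structure GTWitness (k H : Type) [Field k] [Semiring H] [HopfAlgebra k H] : Type 1 where
  L : Type
  [fieldL : Field L]
  [algL : Algebra k L]
  action : HopfAction k H L
  faithful : InnerFaithful k action.act.toLinearMap

/-- A Hopf algebra is Galois-theoretical if it acts inner faithfully and `k`-linearly on a field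
containing `k`. -/
def GaloisTheoretical (k H : Type) [Field k] [Semiring H] [HopfAlgebra k H] : Prop :=
  Nonempty (GTWitness k H)

/-- The set of invariants of a Hopf algebra action. -/
def HopfAction.invariants {k H A : Type} [CommSemiring k] [Semiring H] [HopfAlgebra k H]
    [Semiring A] [Algebra k A] (ha : HopfAction k H A) : Set A :=
  {a : A | ∀ h : H, ha.act h a = Coalgebra.counit (R := k) h • a}

/-- A subcoalgebra: a subspace `V` with `Δ(V) ⊆ V ⊗ V`. -/
def IsSubcoalgebra (k : Type) {H : Type} [CommSemiring k] [Semiring H] [HopfAlgebra k H]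
    (V : Submodule k H) : Prop :=
  ∀ x ∈ V, Coalgebra.comul (R := k) x ∈ LinearMap.range (TensorProduct.map V.subtype V.subtype)

/-- A simple subcoalgebra: a nonzero subcoalgebra with no nonzero proper subcoalgebras. -/
def IsSimpleSubcoalgebra (k : Type) {H : Type} [CommSemiring k] [Semiring H] [HopfAlgebra k H]
    (V : Submodule k H) : Prop :=
  IsSubcoalgebra k V ∧ V ≠ ⊥ ∧
    ∀ W : Submodule k H, IsSubcoalgebra k W → W ≤ V → W = ⊥ ∨ W = V

/-- The coradical of a Hopf algebra: the sum of all its simple subcoalgebras. -/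
def coradical (k H : Type) [CommSemiring k] [Semiring H] [HopfAlgebra k H] : Submodule k H :=
  sSup {V : Submodule k H | IsSimpleSubcoalgebra k V}

/-- A Hopf algebra is pointed iff its coradical is spanned by the grouplike elements. -/
def IsPointedHopf (k H : Type) [CommSemiring k] [Semiring H] [HopfAlgebra k H] : Prop :=
  coradical k H = Submodule.span k {g : H | IsGrouplike k g}

/-- An algebraic locally-Leibniz operator on a commutative domain in char 0 is zero. -/
theorem aux_derivation_zero {k A : Type} [Field k] [IsAlgClosed k] [CharZero k]
    [CommRing A] [IsDomain A] [Algebra k A] (D : Module.End k A)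
    (hD : ∀ a b, D (a * b) = a * D b + D a * b) (hint : IsIntegral k D) : D = 0 := by
  obtain ⟨p, hp, hpD⟩ := hint
  have hpD : Polynomial.aeval D p = 0 := hpD
  have hc0 : CharZero A := charZero_of_injective_algebraMap (algebraMap k A).injective
  -- no nonzero eigenvalues
  have heig : ∀ (c : k) (v : A), c ≠ 0 → D v = c • v → v = 0 := by
    intro c v hc hv
    by_contra hv0
    have hpow : ∀ n : ℕ, D (v ^ (n + 1)) = (((n + 1 : ℕ) : k) * c) • v ^ (n + 1) := by
      intro n
      induction n with
      | zero => simp [hv]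
      | succ n ih =>
        rw [pow_succ v (n + 1), hD, ih, hv]
        simp only [Algebra.smul_def, map_mul, map_natCast]
        push_cast
        ring
    have hroot : ∀ n : ℕ, p.IsRoot (((n + 1 : ℕ) : k) * c) := by
      intro n
      have h1 : Polynomial.aeval D p (v ^ (n + 1)) =
          p.eval (((n + 1 : ℕ) : k) * c) • v ^ (n + 1) := by
        apply Module.End.aeval_apply_of_hasEigenvector
        exact ⟨Module.End.mem_eigenspace_iff.2 (hpow n), pow_ne_zero _ hv0⟩
      rw [hpD] at h1
      have h2 := (smul_eq_zero.1 h1.symm)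
      exact h2.resolve_right (pow_ne_zero _ hv0)
    have hinf : Set.Infinite {r | p.IsRoot r} := by
      refine Set.infinite_of_injective_forall_mem (f := fun n : ℕ => (((n + 1 : ℕ) : k) * c)) ?_ hroot
      intro a b hab
      have := mul_right_cancel₀ hc hab
      have := Nat.cast_injective this
      omega
    exact hp.ne_zero (Polynomial.eq_zero_of_infinite_isRoot p hinf)
  have hnil : ∀ (s : Multiset k) (v : A),
      Polynomial.aeval D (s.map (fun a => Polynomial.X - Polynomial.C a)).prod v = 0 →
      (D ^ Multiset.card s) v = 0 := by
    intro s
    induction s using Multiset.induction_on with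
    | empty => intro v; simp
    | cons c s ih =>
      intro v hv
      rw [Multiset.map_cons, Multiset.prod_cons] at hv
      rw [Multiset.card_cons]
      by_cases hc : c = 0
      · subst hc
        rw [mul_comm, map_mul] at hv
        rw [pow_succ]
        simp only [map_zero, sub_zero, Polynomial.aeval_X, Module.End.mul_apply] at hv ⊢
        exact ih _ hv
      · rw [map_mul] at hv
        simp only [map_sub, Polynomial.aeval_X, Polynomial.aeval_C, Module.End.mul_apply,
          LinearMap.sub_apply, Module.algebraMap_end_apply] at hv
        have := ih v (heig c _ hc (sub_eq_zero.1 hv))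
        rw [pow_succ', Module.End.mul_apply, this, map_zero]
  have hDn : D ^ Multiset.card p.roots = 0 := by
    ext v
    apply hnil
    have := (IsAlgClosed.splits p).eq_prod_roots_of_monic hp
    rw [← this, hpD]; rfl
  -- nilpotent
  have hnilp : IsNilpotent D := ⟨_, hDn⟩
  have key : ∀ a c : A, D a = c → D c = 0 → c = 0 := by
    intro a c hac hc
    have hcp : ∀ j : ℕ, D (c ^ j) = 0 := by
      intro j
      induction j with
      | zero =>
        have := hD 1 1
        simp only [mul_one, one_mul] at this
        simpa using this
      | succ j ih => rw [pow_succ, hD, ih, hc]; simp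
    have hap : ∀ m : ℕ, D (a ^ (m + 1)) = (m + 1 : ℕ) * a ^ m * c := by
      intro m
      induction m with
      | zero => simp [hac]
      | succ m ih => rw [pow_succ a (m + 1), hD, ih, hac]; push_cast; ring
    have h : ∀ m j : ℕ, (D ^ m) (a ^ m * c ^ j) = (m.factorial : A) * c ^ (m + j) := by
      intro m
      induction m with
      | zero => intro j; simp
      | succ m ih =>
        intro j
        rw [pow_succ, Module.End.mul_apply, hD, hap, hcp]
        have : a ^ (m + 1) * 0 + ((m + 1 : ℕ) : A) * a ^ m * c * c ^ j =
          (m + 1 : ℕ) • (a ^ m * c ^ (j + 1)) := by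
          rw [nsmul_eq_mul]; ring
        rw [this, map_nsmul, ih, nsmul_eq_mul, Nat.factorial_succ]
        push_cast; ring
    obtain ⟨n, hn⟩ := hnilp
    have h2 := h n 0
    rw [hn] at h2
    have h3 := h2.symm
    rw [LinearMap.zero_apply, mul_eq_zero] at h3
    rcases h3 with h3 | h3
    · exact absurd (Nat.cast_eq_zero.1 h3) (Nat.factorial_ne_zero n)
    · exact eq_zero_of_pow_eq_zero h3
  have hall : ∀ n : ℕ, D ^ (n + 1) = 0 → D = 0 := by
    intro n
    induction n with
    | zero => intro h; simpa using h
    | succ n ih =>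
      intro h
      apply ih
      ext v
      rw [LinearMap.zero_apply]
      apply key ((D ^ n) v)
      · rw [pow_succ', Module.End.mul_apply]
      · rw [← Module.End.mul_apply, ← pow_succ', h]; rfl
  obtain ⟨n, hn⟩ := hnilp
  exact hall n (by rw [pow_succ, hn, zero_mul])

theorem aux_counit_grouplike {k H : Type} [Field k] [Ring H] [HopfAlgebra k H] {g : H}
    (hg : IsGrouplike k g) : Coalgebra.counit (R := k) g = 1 := by
  have h := Coalgebra.rTensor_counit_comul (R := k) g
  rw [hg.2, LinearMap.rTensor_tmul] at h
  have h2 := congrArg (TensorProduct.lid k H) h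
  simp only [TensorProduct.lid_tmul, one_smul] at h2
  have h3 : (Coalgebra.counit (R := k) g - 1) • g = 0 := by rw [sub_smul, h2, one_smul, sub_self]
  exact sub_eq_zero.1 ((smul_eq_zero.1 h3).resolve_right hg.1)

theorem aux_counit_skew {k H : Type} [Field k] [Ring H] [HopfAlgebra k H] {g x : H}
    (hg : IsGrouplike k g)
    (hx : Coalgebra.comul (R := k) x = g ⊗ₜ[k] x + x ⊗ₜ[k] (1 : H)) :
    Coalgebra.counit (R := k) x = 0 := by
  have h := Coalgebra.rTensor_counit_comul (R := k) x
  rw [hx, map_add, LinearMap.rTensor_tmul, LinearMap.rTensor_tmul] at h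
  have h2 := congrArg (fun t => Coalgebra.counit (R := k) (TensorProduct.lid k H t)) h
  simpa [aux_counit_grouplike hg] using h2

theorem aux_act_grouplike {k H A : Type} [Field k] [Ring H] [HopfAlgebra k H]
    [CommRing A] [Algebra k A] (ha : HopfAction k H A) {g : H}
    (hg : IsGrouplike k g) (a b : A) : ha.act g (a * b) = ha.act g a * ha.act g b := by
  rw [ha.act_mul, hg.2]; simp [LinearMap.flip_apply]

theorem aux_act_skew {k H A : Type} [Field k] [Ring H] [HopfAlgebra k H]
    [CommRing A] [Algebra k A] (ha : HopfAction k H A) {g x : H}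
    (hx : Coalgebra.comul (R := k) x = g ⊗ₜ[k] x + x ⊗ₜ[k] (1 : H)) (a b : A) :
    ha.act x (a * b) = ha.act g a * ha.act x b + ha.act x a * b := by
  rw [ha.act_mul, hx]; simp [LinearMap.flip_apply]

theorem aux_skew_zero {k H A : Type} [Field k] [IsAlgClosed k] [CharZero k]
    [Ring H] [HopfAlgebra k H]
    [CommRing A] [IsDomain A] [Algebra k A] (ha : HopfAction k H A) {g x : H}
    (hx : Coalgebra.comul (R := k) x = g ⊗ₜ[k] x + x ⊗ₜ[k] (1 : H))
    (hfd : Module.Finite k ↥(Algebra.adjoin k {g, x})) (a : A) (hga : ha.act g a = a) :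
    ha.act x a = 0 := by
  by_cases hb : ∃ b, ha.act g b ≠ b
  · obtain ⟨b, hb⟩ := hb
    have h1 := aux_act_skew ha hx a b
    rw [mul_comm a b, aux_act_skew ha hx b a, hga] at h1
    have h2 : (ha.act g b - b) * ha.act x a = 0 := by linear_combination h1
    exact (mul_eq_zero.1 h2).resolve_left (sub_ne_zero.2 hb)
  · push Not at hb
    have hint : IsIntegral k x := by
      have hxm : x ∈ Algebra.adjoin k {g, x} := Algebra.subset_adjoin (by simp)
      have h0 : IsIntegral k (⟨x, hxm⟩ : ↥(Algebra.adjoin k {g, x})) :=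
        Algebra.IsIntegral.isIntegral _
      exact h0.map (Algebra.adjoin k {g, x}).val
    have := aux_derivation_zero (ha.act x)
      (fun a b => by rw [aux_act_skew ha hx, hb]) (hint.map ha.act)
    rw [this]; rfl

/-- The Hopf ideal generated by `φ σ - 1` for `σ` in a subgroup. -/
def auxIdeal (k H G : Type) [Field k] [Ring H] [HopfAlgebra k H] [Group G] (φ : G →* H)
    (hφgl : ∀ σ : G, IsGrouplike k (φ σ)) (N : Subgroup G) : HopfIdeal k H where
  carrier := Submodule.span k {y | ∃ a b : H, ∃ σ ∈ N, y = a * (φ σ - 1) * b}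
  mul_mem_left := by
    intro a x hx
    induction hx using Submodule.span_induction with
    | mem x h =>
      obtain ⟨c, b, σ, hσ, rfl⟩ := h
      exact Submodule.subset_span ⟨a * c, b, σ, hσ, by simp only [mul_assoc]⟩
    | zero => simp
    | add x y _ _ hx hy => rw [mul_add]; exact add_mem hx hy
    | smul r x _ hx => rw [mul_smul_comm]; exact Submodule.smul_mem _ _ hx
  mul_mem_right := by
    intro a x hx
    induction hx using Submodule.span_induction with
    | mem x h =>
      obtain ⟨c, b, σ, hσ, rfl⟩ := h
      exact Submodule.subset_span ⟨c, b * a, σ, hσ, by simp only [mul_assoc]⟩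
    | zero => simp
    | add x y _ _ hx hy => rw [add_mul]; exact add_mem hx hy
    | smul r x _ hx => rw [smul_mul_assoc]; exact Submodule.smul_mem _ _ hx
  comul_mem := by
    intro x hx
    induction hx using Submodule.span_induction with
    | mem x h =>
      obtain ⟨a, b, σ, hσ, rfl⟩ := h
      rw [Bialgebra.comul_mul, Bialgebra.comul_mul, map_sub, (hφgl σ).2, Bialgebra.comul_one]
      generalize Coalgebra.comul (R := k) a = t
      generalize Coalgebra.comul (R := k) b = u
      induction t with
      | zero => simp
      | add t₁ t₂ h₁ h₂ => rw [add_mul, add_mul]; exact add_mem h₁ h₂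
      | tmul a₁ a₂ =>
        induction u with
        | zero => simp
        | add t₁ t₂ h₁ h₂ => rw [mul_add]; exact add_mem h₁ h₂
        | tmul b₁ b₂ =>
          have e : a₁ ⊗ₜ[k] a₂ * (φ σ ⊗ₜ[k] φ σ - 1) * b₁ ⊗ₜ[k] b₂ =
              (a₁ * (φ σ - 1) * b₁) ⊗ₜ[k] (a₂ * 1 * b₂) +
              (a₁ * φ σ * b₁) ⊗ₜ[k] (a₂ * (φ σ - 1) * b₂) := by
            rw [Algebra.TensorProduct.one_def]
            simp only [mul_sub, sub_mul, Algebra.TensorProduct.tmul_mul_tmul,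
              TensorProduct.tmul_sub, TensorProduct.sub_tmul]
            abel
          rw [e]
          apply add_mem
          · apply Submodule.mem_sup_left
            exact ⟨⟨_, Submodule.subset_span ⟨a₁, b₁, σ, hσ, rfl⟩⟩ ⊗ₜ (a₂ * 1 * b₂), by simp⟩
          · apply Submodule.mem_sup_right
            exact ⟨(a₁ * φ σ * b₁) ⊗ₜ ⟨_, Submodule.subset_span ⟨a₂, b₂, σ, hσ, rfl⟩⟩, by simp⟩
    | zero => simp
    | add x y _ _ hx hy => rw [map_add]; exact add_mem hx hy
    | smul r x _ hx => rw [map_smul]; exact Submodule.smul_mem _ _ hx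
  counit_eq_zero := by
    intro x hx
    induction hx using Submodule.span_induction with
    | mem x h =>
      obtain ⟨a, b, σ, hσ, rfl⟩ := h
      simp [aux_counit_grouplike (hφgl σ)]
    | zero => simp
    | add x y _ _ hx hy => rw [map_add, hx, hy, add_zero]
    | smul r x _ hx => rw [map_smul, hx, smul_zero]
  antipode_mem := by
    intro x hx
    induction hx using Submodule.span_induction with
    | mem x h =>
      obtain ⟨a, b, σ, hσ, rfl⟩ := h
      have hS : HopfAlgebra.antipode k (φ σ) = φ σ⁻¹ := by
        have hg : IsGroupLikeElem k (φ σ) := ⟨aux_counit_grouplike (hφgl σ), (hφgl σ).2⟩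
        have h1 := hg.antipode_mul_cancel
        exact left_inv_eq_right_inv h1 (by rw [← map_mul, mul_inv_cancel, map_one])
      refine Submodule.subset_span ⟨HopfAlgebra.antipode k b, HopfAlgebra.antipode k a, σ⁻¹,
        N.inv_mem hσ, ?_⟩
      rw [HopfAlgebra.antipode_mul_antidistrib, HopfAlgebra.antipode_mul_antidistrib, map_sub, hS,
        HopfAlgebra.antipode_one, mul_assoc]
    | zero => simp
    | add x y _ _ hx hy => rw [map_add]; exact add_mem hx hy
    | smul r x _ hx => rw [map_smul]; exact Submodule.smul_mem _ _ hx

/-- **Statement 10.** Let `H` be a Hopf algebra over `k` (not necessarily finite dimensional)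
generated by a finite group `G = G(H)` of grouplike elements (embedded via `φ`) together with
`(g_i, 1)`-skew primitive elements `x_i`, and assume that for each `i` the Hopf subalgebra
generated by `{g_i, x_i}` is finite dimensional.  Then:
(i) `A^H = A^G` for any commutative domain `A` that is an `H`-module algebra;
(ii) if `H` acts inner faithfully on a field `L`, then `L^H = L^G ⊆ L` is a Galois extension
with Galois group `G`. -/
theorem invariants_and_galois_of_skew_primitive_generation
    (k : Type) [Field k] [IsAlgClosed k] [CharZero k]
    (H : Type) [Ring H] [HopfAlgebra k H]
    (G : Type) [Group G] [Finite G] (φ : G →* H)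
    (hφgl : ∀ σ : G, IsGrouplike k (φ σ))
    (hφinj : Function.Injective φ)
    (hφall : ∀ g : H, IsGrouplike k g → g ∈ Set.range φ)
    (ι : Type) (gi : ι → G) (x : ι → H)
    (hskew : ∀ i : ι, Coalgebra.comul (R := k) (x i) =
        (φ (gi i)) ⊗ₜ[k] (x i) + (x i) ⊗ₜ[k] (1 : H))
    (hgen : Algebra.adjoin k (Set.range ⇑φ ∪ Set.range x) = ⊤)
    (hfd : ∀ i : ι, Module.Finite k ↥(Algebra.adjoin k {φ (gi i), x i})) :
    (∀ (A : Type) [CommRing A] [IsDomain A] [Algebra k A] (ha : HopfAction k H A),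
        ha.invariants = {a : A | ∀ σ : G, ha.act (φ σ) a = a}) ∧
    (∀ (L : Type) [Field L] [Algebra k L] (ha : HopfAction k H L),
        InnerFaithful k ha.act.toLinearMap →
        ∃ F : IntermediateField k L,
          (F : Set L) = ha.invariants ∧
          (F : Set L) = {a : L | ∀ σ : G, ha.act (φ σ) a = a} ∧
          IsGalois F L ∧
          ∃ e : G ≃ (L ≃ₐ[F] L), ∀ (σ : G) (r : L), (e σ) r = ha.act (φ σ) r) := by
  have part1 : ∀ (A : Type) [CommRing A] [IsDomain A] [Algebra k A] (ha : HopfAction k H A),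
        ha.invariants = {a : A | ∀ σ : G, ha.act (φ σ) a = a} := by
    intro A _ _ _ ha
    ext a
    constructor
    · intro h σ
      rw [h (φ σ), aux_counit_grouplike (hφgl σ), one_smul]
    · intro h y
      have hy : y ∈ Algebra.adjoin k (Set.range ⇑φ ∪ Set.range x) := by rw [hgen]; trivial
      induction hy using Algebra.adjoin_induction with
      | mem y hy =>
        rcases hy with ⟨σ, rfl⟩ | ⟨i, rfl⟩
        · rw [h σ, aux_counit_grouplike (hφgl σ), one_smul]
        · rw [aux_counit_skew (hφgl _) (hskew i), zero_smul]
          exact aux_skew_zero ha (hskew i) (hfd i) a (h _)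
      | algebraMap r => simp
      | add y z _ _ hy hz => rw [map_add, map_add, LinearMap.add_apply, hy, hz, add_smul]
      | mul y z _ _ hy hz =>
        rw [map_mul, Module.End.mul_apply, hz, map_smul, hy, Bialgebra.counit_mul, smul_smul,
          mul_comm]
  refine ⟨part1, ?_⟩
  intro L _ _ ha hif
  letI act : MulSemiringAction G L :=
    { smul := fun σ r => ha.act (φ σ) r
      one_smul := fun r => by change ha.act (φ 1) r = r; simp
      mul_smul := fun σ τ r => by
        change ha.act (φ (σ * τ)) r = ha.act (φ σ) (ha.act (φ τ) r); simp
      smul_zero := fun σ => map_zero (ha.act (φ σ))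
      smul_add := fun σ => map_add (ha.act (φ σ))
      smul_one := fun σ => by
        change ha.act (φ σ) 1 = 1
        rw [ha.act_one, aux_counit_grouplike (hφgl σ), one_smul]
      smul_mul := fun σ a b => aux_act_grouplike ha (hφgl σ) a b }
  have hsmul : ∀ (σ : G) (r : L), σ • r = ha.act (φ σ) r := fun _ _ => rfl
  let F : IntermediateField k L :=
    { FixedPoints.subfield G L with
      algebraMap_mem' := fun r σ => by
        rw [hsmul, Algebra.algebraMap_eq_smul_one, map_smul, ← hsmul, smul_one] }
  have hF : (F : Set L) = {a : L | ∀ σ : G, ha.act (φ σ) a = a} := rfl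
  have hfaith : FaithfulSMul G L := by
    let N : Subgroup G := (MulSemiringAction.toRingAut G L).ker
    have hN : ∀ σ ∈ N, ∀ r, ha.act (φ σ) r = r := fun σ hσ r =>
      RingEquiv.congr_fun (MonoidHom.mem_ker.1 hσ) r
    have hbot := hif (auxIdeal k H G φ hφgl N) (by
      intro y hy
      change y ∈ Submodule.span k _ at hy
      induction hy using Submodule.span_induction with
      | mem y h =>
        obtain ⟨a, b, σ, hσ, rfl⟩ := h
        ext r
        simp [hN σ hσ]
      | zero => simp
      | add x y _ _ hx hy => rw [map_add, hx, hy, add_zero]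
      | smul r x _ hx => rw [map_smul, hx, smul_zero])
    refine ⟨fun {σ τ} h => ?_⟩
    have hmem : σ⁻¹ * τ ∈ N := by
      apply MonoidHom.mem_ker.2
      ext r
      change (σ⁻¹ * τ) • r = r
      rw [mul_smul, ← h r, inv_smul_smul]
    have h1 : φ (σ⁻¹ * τ) - 1 ∈ (auxIdeal k H G φ hφgl N).carrier :=
      Submodule.subset_span ⟨1, 1, _, hmem, by simp⟩
    rw [hbot, Submodule.mem_bot, sub_eq_zero, ← map_one φ] at h1
    exact inv_mul_eq_one.1 (hφinj h1)
  have hgal : IsGaloisGroup G F L :=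
    { faithful := hfaith
      commutes := ⟨fun σ f r => by
        rw [Algebra.smul_def, Algebra.smul_def, smul_mul']
        congr 1
        exact f.2 σ⟩
      isInvariant := ⟨fun b hb => ⟨⟨b, hb⟩, rfl⟩⟩ }
  refine ⟨F, ?_, hF, IsGaloisGroup.isGalois G F L,
    (IsGaloisGroup.mulEquivAlgEquiv G F L).toEquiv, fun σ r => rfl⟩
  rw [hF, part1 L ha]
end

section
/- Let H be a finite dimensional Hopf algebra over k acting on a commutative domain A as a left H-module algebra. Then A^H = A^{H₀}, where H₀ is the coradical of H and A^{H₀} = {a ∈ A : x·a = ε(x)a for all x ∈ H₀} (this holds even though H₀ need not be a subalgebra of H). -/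
open TensorProduct

theorem aux_le_jacobson {B : Type} [Ring B] [IsArtinianRing B] (J : Ideal B) [J.IsTwoSided]
    (hJ : ∀ M : Ideal B, M.IsTwoSided → M ≠ ⊤ →
      (∀ N : Ideal B, N.IsTwoSided → M ≤ N → N = M ∨ N = ⊤) → J ≤ M) :
    J ≤ Ring.jacobson B := by
  set R := Ring.jacobson B with hR
  have : IsSemisimpleRing (B ⧸ R) := IsSemiprimaryRing.isSemisimpleRing
  -- left complement
  obtain ⟨K', hK'⟩ := exists_isCompl (Ideal.map (Ideal.Quotient.mk R) J)
  have hinf : ∀ j ∈ J, ∀ x, Ideal.Quotient.mk R x ∈ K' → j * x ∈ R := by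
    intro j hj x hx
    have h1 : Ideal.Quotient.mk R (j * x) ∈ Ideal.map (Ideal.Quotient.mk R) J :=
      Ideal.mem_map_of_mem _ (J.mul_mem_right x hj)
    have h2 : Ideal.Quotient.mk R (j * x) ∈ K' := by
      rw [map_mul]; exact K'.mul_mem_left _ hx
    have h3 := (Submodule.disjoint_def.1 hK'.disjoint) _ h1 h2
    exact Ideal.Quotient.eq_zero_iff_mem.1 h3
  let A : Ideal B :=
    { carrier := {x | ∀ j ∈ J, j * x ∈ R}
      add_mem' := fun {x y} hx hy j hj => by rw [mul_add]; exact R.add_mem (hx j hj) (hy j hj)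
      zero_mem' := fun j _ => by simp
      smul_mem' := fun c x hx j hj => by
        have := hx (j * c) (J.mul_mem_right c hj)
        simpa [mul_assoc] using this }
  have hA2 : A.IsTwoSided := ⟨fun {x} b hx j hj => by
    rw [← mul_assoc]; exact R.mul_mem_right b (hx j hj)⟩
  have hsum : ∃ j ∈ J, ∃ x ∈ A, j + x = 1 := by
    have h1 : (1 : B ⧸ R) ∈ Ideal.map (Ideal.Quotient.mk R) J ⊔ K' := by
      rw [hK'.sup_eq_top]; trivial
    obtain ⟨u, hu, v, hv, huv⟩ := Submodule.mem_sup.1 h1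
    obtain ⟨j, hj, rfl⟩ := (Ideal.mem_map_iff_of_surjective _ Ideal.Quotient.mk_surjective).1 hu
    refine ⟨j, hj, 1 - j, ?_, by simp⟩
    intro j' hj'
    apply hinf j' hj'
    rw [map_sub, map_one, ← huv]
    simpa using hv
  obtain ⟨j, hj, x, hx, hjx⟩ := hsum
  have htop : A = ⊤ := by
    by_contra hne
    let S : Set (Ideal B) := {M | M.IsTwoSided ∧ M ≠ ⊤ ∧ A ≤ M}
    obtain ⟨M, hM, hmax⟩ := (wellFounded_gt (α := Ideal B)).has_min S ⟨A, hA2, hne, le_rfl⟩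
    have hJM : J ≤ M := hJ M hM.1 hM.2.1 (fun N hN hMN => by
      by_cases hNt : N = ⊤
      · exact Or.inr hNt
      · left
        by_contra hne'
        exact hmax N ⟨hN, hNt, hM.2.2.trans hMN⟩ (lt_of_le_of_ne hMN (Ne.symm hne')))
    apply hM.2.1
    rw [Ideal.eq_top_iff_one, ← hjx]
    exact M.add_mem (hJM hj) (hM.2.2 hx)
  intro y hy
  have h1 : (1 : B) ∈ A := by rw [htop]; trivial
  simpa using h1 y hy

theorem aux_nilp {B : Type} [Ring B] [IsArtinianRing B] (J : Ideal B) [J.IsTwoSided]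
    (hJ : ∀ M : Ideal B, M.IsTwoSided → M ≠ ⊤ →
      (∀ N : Ideal B, N.IsTwoSided → M ≤ N → N = M ∨ N = ⊤) → J ≤ M) :
    ∃ n : ℕ, J ^ n = ⊥ := by
  obtain ⟨n, hn⟩ := IsSemiprimaryRing.isNilpotent (R := B)
  refine ⟨n, ?_⟩
  have := Ideal.pow_right_mono (aux_le_jacobson J hJ) n
  rw [hn] at this
  exact le_bot_iff.1 this

section
variable {k : Type} [Field k] {H : Type} [Ring H] [HopfAlgebra k H] [FiniteDimensional k H]

open WithConv

theorem aux_conv_zero {A : Type} [CommRing A] [Algebra k A] {V : Submodule k H}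
    (hV : IsSubcoalgebra k V) (f g : WithConv (H →ₗ[k] A))
    (h : (∀ x ∈ V, f x = 0) ∨ (∀ x ∈ V, g x = 0)) : ∀ x ∈ V, (f * g) x = 0 := by
  intro x hx
  obtain ⟨t, ht⟩ := hV x hx
  rw [LinearMap.convMul_apply, ← ht, ← LinearMap.comp_apply (TensorProduct.map _ _),
    ← TensorProduct.map_comp]
  rcases h with h | h
  · have : f.ofConv ∘ₗ V.subtype = 0 := by ext y; exact h y y.2
    simp [this]
  · have : g.ofConv ∘ₗ V.subtype = 0 := by ext y; exact h y y.2
    simp [this]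

theorem aux_sep {t : H ⊗[k] H}
    (h : ∀ φ ψ : H →ₗ[k] k, LinearMap.mul' k k (TensorProduct.map φ ψ t) = 0) : t = 0 := by
  let b := Module.finBasis k H
  apply (b.tensorProduct b).repr.injective
  ext ⟨i, j⟩
  have := h (b.coord i) (b.coord j)
  rw [map_zero, Finsupp.zero_apply, ← this]
  clear this h
  induction t with
  | zero => simp
  | add x y hx hy => simp [hx, hy]
  | tmul x y => simp [Module.Basis.tensorProduct_repr_tmul_apply, mul_comm]

theorem aux_mem {V : Submodule k H} {t : H ⊗[k] H}
    (h1 : ∀ φ ψ : H →ₗ[k] k, (∀ x ∈ V, φ x = 0) →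
      LinearMap.mul' k k (TensorProduct.map φ ψ t) = 0)
    (h2 : ∀ φ ψ : H →ₗ[k] k, (∀ x ∈ V, ψ x = 0) →
      LinearMap.mul' k k (TensorProduct.map φ ψ t) = 0) :
    t ∈ LinearMap.range (TensorProduct.map V.subtype V.subtype) := by
  obtain ⟨p, hp⟩ := V.subtype.exists_leftInverse_of_injective (by simp)
  have hp' : ∀ x ∈ V, V.subtype (p x) = x := fun x hx => by
    have := LinearMap.congr_fun hp ⟨x, hx⟩
    simp at this
    simp [this]
  refine ⟨TensorProduct.map p p t, ?_⟩
  rw [← sub_eq_zero]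
  apply aux_sep
  intro φ ψ
  let π := V.subtype ∘ₗ p
  have e1 := h1 (φ ∘ₗ π - φ) (ψ ∘ₗ π) (fun x hx => by simp [π] at hp' ⊢; simp [hp' x hx])
  have e2 := h2 φ (ψ ∘ₗ π - ψ) (fun x hx => by simp [π] at hp' ⊢; simp [hp' x hx])
  have : TensorProduct.map φ ψ (TensorProduct.map V.subtype V.subtype (TensorProduct.map p p t))
      = TensorProduct.map (φ ∘ₗ π) (ψ ∘ₗ π) t := by
    simp only [← LinearMap.comp_apply, ← TensorProduct.map_comp]
    rfl
  rw [map_sub, map_sub, this]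
  have s1 : ∀ φ φ' ψ : H →ₗ[k] k, TensorProduct.map (φ - φ') ψ t =
      TensorProduct.map φ ψ t - TensorProduct.map φ' ψ t := fun φ φ' ψ => by
    rw [eq_sub_iff_add_eq, ← LinearMap.add_apply, ← TensorProduct.map_add_left, sub_add_cancel]
  have s2 : ∀ φ φ' ψ : H →ₗ[k] k, TensorProduct.map ψ (φ - φ') t =
      TensorProduct.map ψ φ t - TensorProduct.map ψ φ' t := fun φ φ' ψ => by
    rw [eq_sub_iff_add_eq, ← LinearMap.add_apply, ← TensorProduct.map_add_right, sub_add_cancel]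
  rw [s1, map_sub] at e1
  rw [s2, map_sub] at e2
  linear_combination e1 + e2

/-- annihilator ideal of a subspace -/
def annId (V : Submodule k H) (hV : ∀ f g : WithConv (H →ₗ[k] k),
    ((∀ x ∈ V, f x = 0) ∨ (∀ x ∈ V, g x = 0)) → ∀ x ∈ V, (f * g) x = 0) :
    Ideal (WithConv (H →ₗ[k] k)) where
  carrier := {f | ∀ x ∈ V, f x = 0}
  add_mem' := fun {f g} hf hg x hx => by
    change f x + g x = 0
    rw [hf x hx, hg x hx, add_zero]
  zero_mem' := fun x _ => rfl
  smul_mem' := fun c f hf x hx => hV c f (Or.inr hf) x hx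

theorem aux_coradical {A : Type} [CommRing A] [Algebra k A] (f g : WithConv (H →ₗ[k] A))
    (h : (∀ x ∈ coradical k H, f x = 0) ∨ (∀ x ∈ coradical k H, g x = 0)) :
    ∀ x ∈ coradical k H, (f * g) x = 0 := by
  intro x hx
  have : coradical k H ≤ LinearMap.ker (f * g).ofConv := by
    apply sSup_le
    intro V hV y hy
    have hle : V ≤ coradical k H := le_sSup hV
    exact aux_conv_zero hV.1 f g
      (h.imp (fun h x hx => h x (hle hx)) (fun h x hx => h x (hle hx))) y hy
  exact this hx

theorem aux_max (M : Ideal (WithConv (H →ₗ[k] k))) (hM : M.IsTwoSided) (hne : M ≠ ⊤)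
    (hmax : ∀ N : Ideal (WithConv (H →ₗ[k] k)), N.IsTwoSided → M ≤ N → N = M ∨ N = ⊤)
    (f : WithConv (H →ₗ[k] k)) (hf : ∀ x ∈ coradical k H, f x = 0) : f ∈ M := by
  let M' : Submodule k (Module.Dual k H) :=
    (M.restrictScalars k).map (WithConv.linearEquiv k (H →ₗ[k] k)).toLinearMap
  have hM' : ∀ φ, φ ∈ M' ↔ toConv φ ∈ M := by
    intro φ
    constructor
    · rintro ⟨g, hg, rfl⟩; exact hg
    · intro h; exact ⟨toConv φ, h, rfl⟩
  let V : Submodule k H := M'.dualCoannihilator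
  have hV : ∀ x, x ∈ V ↔ ∀ g ∈ M, g x = 0 := by
    intro x
    rw [Submodule.mem_dualCoannihilator]
    exact ⟨fun h g hg => h g.ofConv ((hM' _).2 hg), fun h φ hφ => h (toConv φ) ((hM' _).1 hφ)⟩
  have hMV : ∀ g : WithConv (H →ₗ[k] k), (∀ x ∈ V, g x = 0) → g ∈ M := by
    intro g hg
    have : g.ofConv ∈ M'.dualCoannihilator.dualAnnihilator := by
      rw [Submodule.mem_dualAnnihilator]; exact hg
    have hfd : FiniteDimensional k M' := FiniteDimensional.finiteDimensional_submodule (V := Module.Dual k H) M'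
    rw [Subspace.dualCoannihilator_dualAnnihilator_eq (W := M')] at this
    exact (hM' _).1 this
  have hsub : IsSubcoalgebra k V := by
    intro x hx
    apply aux_mem
    · intro φ ψ h
      exact (hV x).1 hx (toConv φ * toConv ψ) (M.mul_mem_right _ (hMV _ h))
    · intro φ ψ h
      exact (hV x).1 hx (toConv φ * toConv ψ) (M.mul_mem_left _ (hMV _ h))
  have hsimple : IsSimpleSubcoalgebra k V := by
    refine ⟨hsub, ?_, ?_⟩
    · intro hbot
      apply hne
      rw [Ideal.eq_top_iff_one]
      apply hMV
      intro x hx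
      rw [hbot, Submodule.mem_bot] at hx
      rw [hx]; exact map_zero _
    · intro W hW hWV
      let N := annId W (fun f g h => aux_conv_zero hW f g h)
      have hN : N.IsTwoSided := ⟨fun {f} g hf => aux_conv_zero hW f g (Or.inl hf)⟩
      rcases hmax N hN (fun g hg x hx => (hV x).1 (hWV hx) g hg) with h | h
      · right
        apply le_antisymm hWV
        intro x hx
        rw [← Subspace.dualAnnihilator_dualCoannihilator_eq (W := W),
          Submodule.mem_dualCoannihilator]
        intro φ hφ
        rw [Submodule.mem_dualAnnihilator] at hφ
        have : toConv φ ∈ N := hφ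
        rw [h] at this
        exact (hV x).1 hx _ this
      · left
        rw [eq_bot_iff]
        intro x hx
        rw [Submodule.mem_bot, ← Module.forall_dual_apply_eq_zero_iff k]
        intro φ
        have : toConv φ ∈ N := by rw [h]; trivial
        exact this x hx
  have hle : V ≤ coradical k H := le_sSup hsimple
  exact hMV f (fun x hx => hf x (hle hx))

theorem aux_dual_nilp : ∃ n : ℕ,
    (annId (coradical k H) (fun f g h => aux_coradical f g h)) ^ n = ⊥ := by
  have : IsArtinianRing (WithConv (H →ₗ[k] k)) := by
    have : Module.Finite k (WithConv (H →ₗ[k] k)) :=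
      Module.Finite.equiv (WithConv.linearEquiv k (H →ₗ[k] k)).symm
    exact IsArtinianRing.of_finite k _
  have : (annId (coradical k H) (fun f g h => aux_coradical f g h)).IsTwoSided :=
    ⟨fun {f} g hf => aux_coradical f g (Or.inl hf)⟩
  apply aux_nilp
  intro M hM hne hmax f hf
  exact aux_max M hM hne hmax f hf

theorem aux_nilp_A {A : Type} [CommRing A] [Algebra k A] (D : WithConv (H →ₗ[k] A))
    (hD : ∀ x ∈ coradical k H, D x = 0) : ∃ n : ℕ, D ^ n = 0 := by
  obtain ⟨n, hn⟩ := aux_dual_nilp (k := k) (H := H)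
  refine ⟨n, ?_⟩
  set J := annId (coradical k H) (fun f g h => aux_coradical f g h) with hJ
  let T : A → WithConv (H →ₗ[k] k) → WithConv (H →ₗ[k] A) := fun a φ =>
    toConv ((LinearMap.toSpanSingleton k A a) ∘ₗ φ.ofConv)
  have hT : ∀ a b φ ψ, T a φ * T b ψ = T (a * b) (φ * ψ) := by
    intro a b φ ψ
    ext x
    simp only [T, LinearMap.convMul_apply, LinearMap.convMul_def, LinearMap.comp_apply,
      WithConv.ofConv_toConv]
    induction (Coalgebra.comul (R := k) x) with
    | zero => simp
    | add x y hx hy => simp only [map_add, hx, hy]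
    | tmul x y => simp [smul_smul, mul_comm]
  let K1 : Submodule k (WithConv (H →ₗ[k] A)) :=
    Submodule.span k {F | ∃ a, ∃ φ ∈ J, F = T a φ}
  let Kn : ℕ → Submodule k (WithConv (H →ₗ[k] A)) := fun m =>
    Submodule.span k {F | ∃ a, ∃ φ ∈ J ^ m, F = T a φ}
  have h1 : D ∈ K1 := by
    let C := coradical k H
    let b := Module.finBasis k (H ⧸ C)
    let Db := C.liftQ D.ofConv hD
    have : D = ∑ i, T (Db (b i)) (toConv (b.coord i ∘ₗ C.mkQ)) := by
      ext x
      have h := b.sum_repr (C.mkQ x)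
      have h2 : D x = Db (C.mkQ x) := rfl
      change D x = _
      conv_lhs => rw [h2, ← h, map_sum]
      simp [T, WithConv.ofConv_sum, LinearMap.sum_apply]
    rw [this]
    refine Submodule.sum_mem _ (fun i _ => Submodule.subset_span ⟨_, _, ?_, rfl⟩)
    intro x hx
    change b.coord i (C.mkQ x) = 0
    have : C.mkQ x = 0 := by simpa using hx
    rw [this, map_zero]
  have hstep : ∀ m, ∀ E ∈ Kn m, E * D ∈ Kn (m + 1) := by
    intro m E hE
    refine Submodule.span_induction₂ (p := fun E D _ _ => E * D ∈ Kn (m + 1))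
      ?_ ?_ ?_ ?_ ?_ ?_ ?_ hE h1
    · rintro _ _ ⟨a, φ, hφ, rfl⟩ ⟨b, ψ, hψ, rfl⟩
      rw [hT]
      refine Submodule.subset_span ⟨_, _, ?_, rfl⟩
      rw [Submodule.pow_succ]
      exact Ideal.mul_mem_mul hφ hψ
    · intro y _; simp
    · intro y _; simp
    · intro x y z _ _ _ h h'; rw [add_mul]; exact add_mem h h'
    · intro x y z _ _ _ h h'; rw [mul_add]; exact add_mem h h'
    · intro r x y _ _ h; rw [smul_mul_assoc]; exact Submodule.smul_mem _ _ h
    · intro r x y _ _ h; rw [mul_smul_comm]; exact Submodule.smul_mem _ _ h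
  have hall : ∀ m, D ^ m ∈ Kn m := by
    intro m
    induction m with
    | zero =>
      rw [pow_zero]
      refine Submodule.subset_span ⟨1, 1, ?_, ?_⟩
      · rw [Submodule.pow_zero]; exact Submodule.one_le.1 le_rfl
      · ext x
        simp [T, Algebra.algebraMap_eq_smul_one]
    | succ m ih => rw [pow_succ]; exact hstep _ _ ih
  have hz : Kn n = ⊥ := by
    rw [eq_bot_iff]
    refine Submodule.span_le.2 ?_
    rintro _ ⟨a, φ, hφ, rfl⟩
    rw [hn, Submodule.mem_bot] at hφ
    simp [T, hφ]
  have := hall n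
  rw [hz] at this
  simpa using this
end

section
open WithConv
variable {k : Type} [Field k] {H : Type} [Ring H] [HopfAlgebra k H]
  {A : Type} [CommRing A] [Algebra k A]

/-- the orbit map -/
noncomputable def orb (ha : HopfAction k H A) (a : A) : WithConv (H →ₗ[k] A) :=
  toConv ((ha.act.toLinearMap : H →ₗ[k] A →ₗ[k] A).flip a)

theorem orb_apply (ha : HopfAction k H A) (a : A) (h : H) : orb ha a h = ha.act h a := rfl

theorem orb_mul (ha : HopfAction k H A) (a b : A) : orb ha (a * b) = orb ha a * orb ha b := by
  ext h
  exact ha.act_mul h a b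

theorem orb_pow (ha : HopfAction k H A) (a : A) (n : ℕ) : orb ha (a ^ n) = orb ha a ^ n := by
  induction n with
  | zero =>
    ext h
    simpa [Algebra.algebraMap_eq_smul_one, orb] using ha.act_one h
  | succ n ih => rw [pow_succ, pow_succ, orb_mul, ih]

theorem aux_twist (ha : HopfAction k H A) (c z : A) (g : H) :
    TensorProduct.lift
      (LinearMap.mk₂ k (fun g₁ g₂ => ha.act g₁ (c * ha.act (HopfAlgebra.antipode k g₂) z))
        (by intros; simp) (by intros; simp) (by intros; simp [mul_add])
        (by intros; simp)) (Coalgebra.comul (R := k) g)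
      = ha.act g c * z := by
  let fc := (orb ha c).ofConv
  let fz := (orb ha z).ofConv
  -- F (g₁ ⊗ g₂ ⊗ g₃) = (g₁ c) (g₂ S(g₃) z)
  let F : H ⊗[k] (H ⊗[k] H) →ₗ[k] A :=
    LinearMap.mul' k A ∘ₗ TensorProduct.map fc
      (fz ∘ₗ LinearMap.mul' k H ∘ₗ (HopfAlgebra.antipode k).lTensor H)
  have h1 : ∀ t : H ⊗[k] H, TensorProduct.lift
      (LinearMap.mk₂ k (fun g₁ g₂ => ha.act g₁ (c * ha.act (HopfAlgebra.antipode k g₂) z))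
        (by intros; simp) (by intros; simp) (by intros; simp [mul_add])
        (by intros; simp)) t =
      F (TensorProduct.assoc k H H H ((Coalgebra.comul (R := k)).rTensor H t)) := by
    intro t
    induction t with
    | zero => simp
    | add x y hx hy => simp only [map_add, hx, hy]
    | tmul x y =>
      simp only [TensorProduct.lift.tmul, LinearMap.mk₂_apply, LinearMap.rTensor_tmul]
      rw [ha.act_mul]
      induction (Coalgebra.comul (R := k) x) with
      | zero => simp
      | add x y hx hy => simp only [map_add, TensorProduct.add_tmul, hx, hy]
      | tmul u v => simp [F, fc, fz, orb]
  rw [h1, Coalgebra.coassoc_apply]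
  have h2 : ∀ t : H ⊗[k] H, F ((Coalgebra.comul (R := k)).lTensor H t) =
      LinearMap.mul' k A (TensorProduct.map fc (LinearMap.toSpanSingleton k A z)
        ((Coalgebra.counit (R := k)).lTensor H t)) := by
    intro t
    induction t with
    | zero => simp
    | add x y hx hy => simp only [map_add, hx, hy]
    | tmul x y =>
      simp [F, fc, fz, orb, HopfAlgebra.mul_antipode_lTensor_comul_apply,
        Algebra.algebraMap_eq_smul_one]
  rw [h2, Coalgebra.lTensor_counit_comul]
  simp [fc, orb]

theorem aux_stable (ha : HopfAction k H A) {ι : Type} (s : Finset ι) (c y : ι → A)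
    (h0 : ∀ h : H, ∑ i ∈ s, c i * ha.act h (y i) = 0) (g h : H) :
    ∑ i ∈ s, ha.act g (c i) * ha.act h (y i) = 0 := by
  simp_rw [← aux_twist ha]
  induction (Coalgebra.comul (R := k) g) with
  | zero => simp
  | add x y hx hy => simp only [map_add, Finset.sum_add_distrib, hx, hy, add_zero]
  | tmul u v =>
    simp only [TensorProduct.lift.tmul, LinearMap.mk₂_apply]
    rw [← map_sum]
    have := h0 (HopfAlgebra.antipode k v * h)
    simp only [map_mul, Module.End.mul_apply] at this
    rw [this, map_zero]

theorem aux_indep {E : Type} [Ring E] [Algebra A E]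
    (htf : ∀ (c : A) (e : E), c • e = 0 → c = 0 ∨ e = 0) (D : E) (m : ℕ) (hm : D ^ (m + 1) = 0)
    (hm' : D ^ m ≠ 0) (r : Polynomial A) (hr : Polynomial.aeval D r = 0) :
    ∀ j ≤ m, r.coeff j = 0 := by
  intro j
  induction j using Nat.strong_induction_on with
  | _ j ih =>
    intro hj
    have h := congrArg (· * D ^ (m - j)) hr
    simp only [zero_mul, Polynomial.aeval_eq_sum_range, Finset.sum_mul] at h
    rw [Finset.sum_eq_single j] at h
    · rw [smul_mul_assoc, ← pow_add, Nat.add_sub_cancel' hj] at h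
      exact (htf _ _ h).resolve_right hm'
    · intro i _ hij
      rcases lt_or_gt_of_ne hij with h1 | h1
      · rw [ih i h1 (by omega), zero_smul, zero_mul]
      · rw [smul_mul_assoc, ← pow_add,
          show i + (m - j) = (m + 1) + (i - j - 1) by omega, pow_add, hm, zero_mul, smul_zero]
    · intro hj'
      rw [Polynomial.coeff_eq_zero_of_natDegree_lt (by simpa using hj'), zero_smul, zero_mul]

end

/-- **Statement 11.** Let `H` be a finite dimensional Hopf algebra over `k` acting on a
commutative domain `A`.  Then `A^H = A^{H₀}`, where `H₀` is the coradical of `H` (even though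
`H₀` need not be a subalgebra of `H`). -/
theorem invariants_eq_coradical_invariants
    (k : Type) [Field k] [IsAlgClosed k] [CharZero k]
    (H : Type) [Ring H] [HopfAlgebra k H] [FiniteDimensional k H]
    (A : Type) [CommRing A] [IsDomain A] [Algebra k A]
    (ha : HopfAction k H A) :
    ha.invariants =
      {a : A | ∀ c ∈ coradical k H, ha.act c a = Coalgebra.counit (R := k) c • a} := by
  classical
  apply Set.Subset.antisymm
  · intro a h c _
    exact h c
  intro a h0
  have h0' : ∀ c ∈ coradical k H, ha.act c a = Coalgebra.counit (R := k) c • a := h0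
  have : Nontrivial A := inferInstance
  have hchar : CharZero A := charZero_of_injective_algebraMap (algebraMap k A).injective
  let f : (WithConv (H →ₗ[k] A)) := orb ha a
  let D : (WithConv (H →ₗ[k] A)) := f - algebraMap A (WithConv (H →ₗ[k] A)) a
  have happ : ∀ (c : A) (x : H), (algebraMap A (WithConv (H →ₗ[k] A)) c).ofConv x = Coalgebra.counit (R := k) x • c := by
    intro c x
    rw [LinearMap.convAlgebraMap_apply, Algebra.algebraMap_eq_smul_one]
    simp
  have hD : ∃ n : ℕ, D ^ n = 0 := by
    apply aux_nilp_A
    intro x hx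
    change f x - (algebraMap A (WithConv (H →ₗ[k] A)) a).ofConv x = 0
    rw [happ, sub_eq_zero]
    exact h0' x hx
  have htf : ∀ (c : A) (e : (WithConv (H →ₗ[k] A))), c • e = 0 → c = 0 ∨ e = 0 := by
    intro c e h
    by_cases hc : c = 0
    · exact Or.inl hc
    · right
      ext x
      have h1 : (c • e).ofConv x = 0 := by rw [h]; rfl
      have h2 : c * e.ofConv x = 0 := h1
      exact (mul_eq_zero.1 h2).resolve_left hc
  have hE1 : (1 : (WithConv (H →ₗ[k] A))) ≠ 0 := by
    intro h
    have h1 : (1 : (WithConv (H →ₗ[k] A))).ofConv (1 : H) = 0 := by rw [h]; rfl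
    rw [LinearMap.convOne_apply] at h1
    simp at h1
  obtain ⟨m, hm, hm'⟩ : ∃ m : ℕ, D ^ (m + 1) = 0 ∧ D ^ m ≠ 0 := by
    have hpos : Nat.find hD ≠ 0 := by
      intro h
      have := Nat.find_spec hD
      rw [h, pow_zero] at this
      exact hE1 this
    obtain ⟨m, hmm⟩ := Nat.exists_eq_succ_of_ne_zero hpos
    refine ⟨m, ?_, Nat.find_min hD (by omega)⟩
    have := Nat.find_spec hD
    rwa [hmm] at this
  -- the polynomial
  let p : Polynomial A := (Polynomial.X - Polynomial.C a) ^ (m + 1)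
  have hmon : p.Monic := (Polynomial.monic_X_sub_C a).pow _
  have hdeg : p.natDegree = m + 1 := by
    simp [p, Polynomial.natDegree_pow]
  have hp : Polynomial.aeval f p = 0 := by
    simp only [p, map_pow, map_sub, Polynomial.aeval_X, Polynomial.aeval_C]
    exact hm
  have hev : ∀ (n : ℕ) (c : ℕ → A) (x : H),
      (Polynomial.aeval f (∑ i ∈ Finset.range n, Polynomial.C (c i) * Polynomial.X ^ i)).ofConv x =
      ∑ i ∈ Finset.range n, c i * ha.act x (a ^ i) := by
    intro n c x
    simp only [map_sum, map_mul, Polynomial.aeval_C, map_pow, Polynomial.aeval_X,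
      ← Algebra.smul_def, WithConv.ofConv_sum, LinearMap.sum_apply]
    refine Finset.sum_congr rfl (fun i _ => ?_)
    rw [← orb_pow]
    rfl
  have hps : p = ∑ i ∈ Finset.range (m + 2), Polynomial.C (p.coeff i) * Polynomial.X ^ i := by
    conv_lhs => rw [p.as_sum_range_C_mul_X_pow, hdeg]
  have hrel : ∀ x : H, ∑ i ∈ Finset.range (m + 2), p.coeff i * ha.act x (a ^ i) = 0 := by
    intro x
    rw [← hev, ← hps, hp]; rfl
  intro g
  let d : ℕ → A := fun i => ha.act g (p.coeff i) - Coalgebra.counit (R := k) g • p.coeff i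
  have hd : ∀ x : H, ∑ i ∈ Finset.range (m + 2), d i * ha.act x (a ^ i) = 0 := by
    intro x
    have h1 := aux_stable ha (Finset.range (m + 2)) p.coeff (fun i => a ^ i) hrel g x
    have h2 := hrel x
    simp only [d, sub_mul, Finset.sum_sub_distrib, h1, smul_mul_assoc, ← Finset.smul_sum, h2]
    simp
  have hdtop : d (m + 1) = 0 := by
    have : p.coeff (m + 1) = 1 := by rw [← hdeg]; exact hmon
    simp only [d, this, ha.act_one, sub_self]
  let q : Polynomial A := ∑ i ∈ Finset.range (m + 1), Polynomial.C (d i) * Polynomial.X ^ i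
  have hq : Polynomial.aeval f q = 0 := by
    ext x
    rw [hev]
    have := hd x
    rw [Finset.sum_range_succ, hdtop, zero_mul, add_zero] at this
    rw [this]; rfl
  have hqdeg : q.degree < ((m + 1 : ℕ) : WithBot ℕ) := by
    refine lt_of_le_of_lt (Polynomial.degree_sum_le _ _) ?_
    rw [Finset.sup_lt_iff (WithBot.bot_lt_coe _)]
    intro i hi
    refine lt_of_le_of_lt (Polynomial.degree_C_mul_X_pow_le _ _) ?_
    exact_mod_cast Finset.mem_range.1 hi
  let r : Polynomial A := q.comp (Polynomial.X + Polynomial.C a)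
  have hr : Polynomial.aeval D r = 0 := by
    simp only [r, Polynomial.aeval_comp, map_add, Polynomial.aeval_X, Polynomial.aeval_C]
    rw [show D + algebraMap A (WithConv (H →ₗ[k] A)) a = f by simp [D]]
    exact hq
  have hr0 := aux_indep htf D m hm hm' r hr
  have hrz : r = 0 := by
    ext j
    rw [Polynomial.coeff_zero]
    by_cases hj : j ≤ m
    · exact hr0 j hj
    · apply Polynomial.coeff_eq_zero_of_natDegree_lt
      have h1 : r.natDegree = q.natDegree := by
        simp [r, Polynomial.natDegree_comp]
      have h2 : q.natDegree < m + 1 := by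
        by_cases hq0 : q = 0
        · simp [hq0]
        · exact (Polynomial.natDegree_lt_iff_degree_lt hq0).2 hqdeg
      omega
  have hqz : q = 0 := by
    have : r.comp (Polynomial.X - Polynomial.C a) = q := by
      simp [r, Polynomial.comp_assoc]
    rw [← this, hrz, Polynomial.zero_comp]
  have hdm : d m = 0 := by
    have : q.coeff m = d m := by
      simp [q, Polynomial.coeff_C_mul, Polynomial.coeff_X_pow]
    rw [← this, hqz, Polynomial.coeff_zero]
  have hcm : p.coeff m = -(((m + 1 : ℕ) : k) • a) := by
    have := Polynomial.coeff_X_add_C_pow (-a) (m + 1) m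
    rw [Polynomial.C_neg, ← sub_eq_add_neg] at this
    simp only [p, this]
    simp [Algebra.smul_def]
    ring
  simp only [d, hcm, map_neg, map_smul, smul_neg] at hdm
  rw [smul_comm, neg_sub_neg, ← smul_sub] at hdm
  have h3 := (smul_eq_zero.1 hdm).resolve_left (Nat.cast_ne_zero.2 (Nat.succ_ne_zero m))
  exact (sub_eq_zero.1 h3).symm
end

section
/- Let H be a finite dimensional Hopf algebra over k acting (as a left H-module algebra) on an Azumaya algebra A whose center Z is an integral domain. Set Z^H = Z ∩ A^H and Z^{H₀} = Z ∩ A^{H₀}, where H₀ is the coradical of H. Then: (i) Z^H = Z^{H₀}; (ii) if in addition H is pointed with group of grouplike elements G = G(H), then Z^H = Z^G = Z ∩ {a ∈ A : g·a = a for all g ∈ G}. -/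
open TensorProduct

/-- The bilinear map `A × Aᵐᵒᵖ → End_Z(A)`, `(a, b) ↦ (x ↦ a x b)`. -/
noncomputable def azumayaBil (Z A : Type) [CommRing Z] [Ring A] [Algebra Z A] :
    A →ₗ[Z] Aᵐᵒᵖ →ₗ[Z] Module.End Z A where
  toFun a :=
    { toFun := fun b => (LinearMap.mulLeft Z a) ∘ₗ (LinearMap.mulRight Z b.unop)
      map_add' := fun b b' => by ext x; simp [mul_add]
      map_smul' := fun c b => by ext x; simp [mul_smul_comm, smul_mul_assoc] }
  map_add' a a' := by ext b x; simp [add_mul]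
  map_smul' c a := by ext b x; simp [smul_mul_assoc]

/-- The natural map `A ⊗_Z Aᵐᵒᵖ → End_Z(A)`; the algebra `A` is Azumaya over its center `Z`
iff it is a faithful finitely generated projective `Z`-module and this map is bijective. -/
noncomputable def azumayaMap (Z A : Type) [CommRing Z] [Ring A] [Algebra Z A] :
    (A ⊗[Z] Aᵐᵒᵖ) →ₗ[Z] Module.End Z A :=
  TensorProduct.lift (azumayaBil Z A)

section AzHelpers
open WithConv

theorem az_semisimple_compl {S : Type*} [Ring S] [IsSemisimpleRing S] (I : Ideal S)
    [I.IsTwoSided] (hI : I ≠ ⊥) : ∃ L : Ideal S, L.IsTwoSided ∧ L ≠ ⊤ ∧ I ⊔ L = ⊤ := by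
  obtain ⟨L, hL⟩ := exists_isCompl I
  have h1 : ∀ x ∈ I, ∀ l ∈ L, x * l = 0 := fun x hx l hl => by
    have : x * l ∈ I ⊓ L := ⟨Ideal.IsTwoSided.mul_mem_of_left _ hx, L.mul_mem_left _ hl⟩
    rw [hL.inf_eq_bot] at this
    exact this
  have h2 : ∀ l ∈ L, ∀ x ∈ I, l * x = 0 := fun l hl x hx => by
    obtain ⟨M, hM⟩ := exists_isCompl (Ideal.span {l * x})
    have h1t : (1 : S) ∈ Ideal.span {l * x} ⊔ M := by rw [hM.sup_eq_top]; trivial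
    obtain ⟨u, hu, m, hm, hum⟩ := Submodule.mem_sup.mp h1t
    obtain ⟨s, rfl⟩ := Ideal.mem_span_singleton'.mp hu
    have hz : l * x * (s * (l * x)) = 0 := by
      have := h1 x hx (s * l) (L.mul_mem_left _ hl)
      calc l * x * (s * (l * x)) = l * (x * (s * l)) * x := by noncomm_ring
        _ = 0 := by rw [this]; simp
    have hy : l * x = l * x * m := by
      calc l * x = l * x * (s * (l * x) + m) := by rw [hum, mul_one]
        _ = l * x * m := by rw [mul_add, hz, zero_add]
    have : l * x ∈ Ideal.span {l * x} ⊓ M :=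
      ⟨Ideal.mem_span_singleton_self _, by rw [hy]; exact M.mul_mem_left _ hm⟩
    rw [hM.inf_eq_bot] at this
    exact this
  refine ⟨L, ⟨fun {l} b hl => ?_⟩, ?_, hL.sup_eq_top⟩
  · have hb : b ∈ I ⊔ L := by rw [hL.sup_eq_top]; trivial
    obtain ⟨x, hx, m, hm, rfl⟩ := Submodule.mem_sup.mp hb
    rw [mul_add, h2 l hl x hx, zero_add]
    exact L.mul_mem_left _ hm
  · rintro rfl
    apply hI
    simpa using hL.inf_eq_bot

theorem az_artinian_compl {R : Type*} [Ring R] [IsArtinianRing R] (I : Ideal R)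
    [I.IsTwoSided] (hI : ¬ I ≤ Ring.jacobson R) :
    ∃ L : Ideal R, L.IsTwoSided ∧ L ≠ ⊤ ∧ I ⊔ L = ⊤ := by
  set q := Ideal.Quotient.mk (Ring.jacobson R)
  have hq : Function.Surjective q := Ideal.Quotient.mk_surjective
  have h2 : (I.map q).IsTwoSided := ⟨fun {a} b ha => by
    obtain ⟨x, hx, rfl⟩ := (Ideal.mem_map_iff_of_surjective q hq).mp ha
    obtain ⟨y, rfl⟩ := hq b
    rw [← map_mul]
    exact Ideal.mem_map_of_mem _ (Ideal.IsTwoSided.mul_mem_of_left _ hx)⟩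
  have h3 : I.map q ≠ ⊥ := fun h => hI fun x hx => by
    have : q x ∈ I.map q := Ideal.mem_map_of_mem _ hx
    rw [h] at this
    exact Ideal.Quotient.eq_zero_iff_mem.mp this
  obtain ⟨L, hL, hLt, hIL⟩ := az_semisimple_compl (I.map q) h3
  refine ⟨L.comap q, ⟨fun {a} b ha => ?_⟩, ?_, ?_⟩
  · rw [Ideal.mem_comap, map_mul]
    exact Ideal.IsTwoSided.mul_mem_of_left _ ha
  · intro h
    apply hLt
    rw [Ideal.eq_top_iff_one] at h ⊢
    simpa using h
  · have : (1 : R ⧸ Ring.jacobson R) ∈ I.map q ⊔ L := by rw [hIL]; trivial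
    obtain ⟨u, hu, m, hm, hum⟩ := Submodule.mem_sup.mp this
    obtain ⟨x, hx, rfl⟩ := (Ideal.mem_map_iff_of_surjective q hq).mp hu
    rw [Ideal.eq_top_iff_one]
    have h1 : (1 : R) = x + (1 - x) := by abel
    rw [h1]
    refine Submodule.add_mem_sup hx ?_
    rw [Ideal.mem_comap, map_sub, map_one, ← hum]
    simpa using hm

theorem az_tensor_sep {k H : Type} [Field k] [AddCommGroup H] [Module k H] (t : H ⊗[k] H)
    (h : ∀ g g' : H →ₗ[k] k, LinearMap.mul' k k (TensorProduct.map g g' t) = 0) : t = 0 := by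
  let b := Module.Free.chooseBasis k H
  refine (b.tensorProduct b).ext_elem fun ij => ?_
  have : (b.tensorProduct b).coord ij =
      LinearMap.mul' k k ∘ₗ TensorProduct.map (b.coord ij.1) (b.coord ij.2) := by
    obtain ⟨i, j⟩ := ij
    ext x y; simp [Module.Basis.tensorProduct_repr_tmul_apply, mul_comm]
  have h' := LinearMap.congr_fun this t
  simp only [Module.Basis.coord_apply, LinearMap.comp_apply] at h'
  rw [h', h]; simp

variable {k H : Type} [Field k] [Ring H] [HopfAlgebra k H]

theorem az_map_left_vanish {A : Type} [Ring A] [Algebra k A] {V : Submodule k H} {f g : H →ₗ[k] A} (hf : ∀ v ∈ V, f v = 0)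
    {t : H ⊗[k] H} (ht : t ∈ LinearMap.range (TensorProduct.map V.subtype V.subtype)) :
    TensorProduct.map f g t = 0 := by
  obtain ⟨s, rfl⟩ := ht
  have : f ∘ₗ V.subtype = 0 := by ext v; exact hf v v.2
  rw [← LinearMap.comp_apply, ← TensorProduct.map_comp, this]; simp

theorem az_map_right_vanish {A : Type} [Ring A] [Algebra k A] {V : Submodule k H} {f g : H →ₗ[k] A} (hg : ∀ v ∈ V, g v = 0)
    {t : H ⊗[k] H} (ht : t ∈ LinearMap.range (TensorProduct.map V.subtype V.subtype)) :
    TensorProduct.map f g t = 0 := by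
  obtain ⟨s, rfl⟩ := ht
  have : g ∘ₗ V.subtype = 0 := by ext v; exact hg v v.2
  rw [← LinearMap.comp_apply, ← TensorProduct.map_comp, this]; simp

/-- functionals vanishing on all simple subcoalgebras -/
noncomputable def azI (k H : Type) [Field k] [Ring H] [HopfAlgebra k H] :
    Ideal (WithConv (H →ₗ[k] k)) where
  carrier := {f | ∀ V : Submodule k H, IsSimpleSubcoalgebra k V → ∀ v ∈ V, f v = 0}
  add_mem' hf hg V hV v hv := by simp [hf V hV v hv, hg V hV v hv]
  zero_mem' V hV v hv := by simp
  smul_mem' g f hf V hV v hv := by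
    rw [smul_eq_mul, LinearMap.convMul_apply, az_map_right_vanish (hf V hV) (hV.1 v hv), map_zero]

instance : (azI k H).IsTwoSided := ⟨fun {f} g hf V hV v hv => by
  rw [LinearMap.convMul_apply, az_map_left_vanish (hf V hV) (hV.1 v hv), map_zero]⟩

variable [FiniteDimensional k H]

instance : IsArtinianRing (WithConv (H →ₗ[k] k)) := by
  have : Module.Finite k (WithConv (H →ₗ[k] k)) :=
    Module.Finite.equiv (WithConv.linearEquiv k (H →ₗ[k] k)).symm
  exact IsArtinianRing.of_finite k _

theorem az_exists_simple {U : Submodule k H} (hU : IsSubcoalgebra k U) (h0 : U ≠ ⊥) :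
    ∃ V ≤ U, IsSimpleSubcoalgebra k V := by
  obtain ⟨V, ⟨hV1, hV2, hV3⟩, hV⟩ := WellFounded.has_min (wellFounded_lt (α := Submodule k H))
    {V | V ≤ U ∧ IsSubcoalgebra k V ∧ V ≠ ⊥} ⟨U, le_rfl, hU, h0⟩
  refine ⟨V, hV1, hV2, hV3, fun W hW hWV => ?_⟩
  by_contra! hc
  exact hV W ⟨hWV.trans hV1, hW, hc.1⟩ (lt_of_le_of_ne hWV hc.2)

theorem az_I_le : azI k H ≤ Ring.jacobson (WithConv (H →ₗ[k] k)) := by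
  by_contra hcon
  obtain ⟨L, hL, hLt, hIL⟩ := az_artinian_compl _ hcon
  let Lk : Submodule k (Module.Dual k H) :=
    { carrier := {f | toConv f ∈ L}
      add_mem' := fun {f g} hf hg => L.add_mem hf hg
      zero_mem' := L.zero_mem
      smul_mem' := fun c f hf => by
        have := L.mul_mem_left (algebraMap k _ c) hf
        rwa [← Algebra.smul_def] at this }
  have hdd : Lk.dualCoannihilator.dualAnnihilator = Lk :=
    Subspace.dualCoannihilator_dualAnnihilator_eq
  set U : Submodule k H := Lk.dualCoannihilator with hUdef
  have memL : ∀ f : H →ₗ[k] k, (∀ u ∈ U, f u = 0) → toConv f ∈ L := fun f hf => by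
    have : f ∈ U.dualAnnihilator := (Submodule.mem_dualAnnihilator _).mpr hf
    rw [hdd] at this
    exact this
  have memU : ∀ u ∈ U, ∀ f : WithConv (H →ₗ[k] k), f ∈ L → f u = 0 := fun u hu f hf =>
    (Submodule.mem_dualCoannihilator _).mp hu f.ofConv hf
  have hU0 : U ≠ ⊥ := fun h => hLt <| by
    rw [Ideal.eq_top_iff_one]
    exact memL (1 : WithConv (H →ₗ[k] k)).ofConv fun u hu => by
      rw [h, Submodule.mem_bot] at hu
      rw [hu, map_zero]
  have hUsub : IsSubcoalgebra k U := by
    intro u hu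
    obtain ⟨r, hr⟩ := LinearMap.exists_leftInverse_of_injective U.subtype (by simp)
    set p : H →ₗ[k] H := U.subtype ∘ₗ r with hp
    have hpU : ∀ v ∈ U, p v = v := fun v hv => by
      have := LinearMap.congr_fun hr ⟨v, hv⟩
      simp only [LinearMap.comp_apply, Submodule.subtype_apply, LinearMap.id_apply] at this
      simp [hp, this]
    have e1 : TensorProduct.map (LinearMap.id - p) LinearMap.id (Coalgebra.comul (R := k) u) = 0 := by
      apply az_tensor_sep
      intro g g'
      rw [← LinearMap.comp_apply (TensorProduct.map g g'), ← TensorProduct.map_comp]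
      have hm : toConv (g ∘ₗ (LinearMap.id - p)) * toConv g' ∈ L :=
        Ideal.IsTwoSided.mul_mem_of_left _ (memL _ fun v hv => by simp [hpU v hv])
      exact memU u hu _ hm
    have e2 : TensorProduct.map LinearMap.id (LinearMap.id - p) (Coalgebra.comul (R := k) u) = 0 := by
      apply az_tensor_sep
      intro g g'
      rw [← LinearMap.comp_apply (TensorProduct.map g g'), ← TensorProduct.map_comp]
      have hm : toConv g * toConv (g' ∘ₗ (LinearMap.id - p)) ∈ L :=
        L.mul_mem_left _ (memL _ fun v hv => by simp [hpU v hv])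
      exact memU u hu _ hm
    have e3 : TensorProduct.map p p (Coalgebra.comul (R := k) u) = Coalgebra.comul (R := k) u := by
      change LinearMap.rTensor H (LinearMap.id - p) _ = 0 at e1
      change LinearMap.lTensor H (LinearMap.id - p) _ = 0 at e2
      rw [LinearMap.rTensor_sub, LinearMap.sub_apply, sub_eq_zero, LinearMap.rTensor_id,
        LinearMap.id_apply, LinearMap.rTensor] at e1
      rw [LinearMap.lTensor_sub, LinearMap.sub_apply, sub_eq_zero, LinearMap.lTensor_id,
        LinearMap.id_apply, LinearMap.lTensor] at e2
      have : TensorProduct.map p p = TensorProduct.map p LinearMap.id ∘ₗ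
          TensorProduct.map (LinearMap.id (R := k) (M := H)) p := by
        rw [← TensorProduct.map_comp]; simp
      rw [this, LinearMap.comp_apply, ← e2, ← e1]
    rw [← e3, hp, TensorProduct.map_comp]
    exact ⟨_, rfl⟩
  obtain ⟨V, hVU, hV⟩ := az_exists_simple hUsub hU0
  have h1 : (1 : WithConv (H →ₗ[k] k)) ∈ azI k H ⊔ L := by rw [hIL]; trivial
  obtain ⟨f, hf, g, hg, hfg⟩ := Submodule.mem_sup.mp h1
  have hε : ∀ v ∈ V, (1 : WithConv (H →ₗ[k] k)) v = 0 := fun v hv => by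
    rw [← hfg]
    simp [hf V hV v hv, memU v (hVU hv) g hg]
  apply hV.2.1
  rw [eq_bot_iff]
  intro v hv
  have h2 := Coalgebra.rTensor_counit_comul (R := k) v
  obtain ⟨s, hs⟩ := hV.1 v hv
  have : (Coalgebra.counit (R := k) (A := H)) ∘ₗ V.subtype = 0 := by
    ext w; simpa using hε w w.2
  rw [← hs, LinearMap.rTensor, ← LinearMap.comp_apply, ← TensorProduct.map_comp, this] at h2
  have h3 := congrArg (TensorProduct.lid k H) h2
  simpa using h3.symm

theorem az_nilp {A : Type} [Ring A] [Algebra k A] (n : WithConv (H →ₗ[k] A))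
    (hn : ∀ c ∈ coradical k H, n c = 0) : IsNilpotent n := by
  set J := Ring.jacobson (WithConv (H →ₗ[k] k))
  obtain ⟨N, hN⟩ : IsNilpotent J := IsSemiprimaryRing.isNilpotent
  let S : ℕ → Submodule k (WithConv (H →ₗ[k] A)) := fun i =>
    Submodule.span k {φ | ∃ f ∈ J ^ i, ∃ a : A, φ = toConv (f.ofConv.smulRight a)}
  have hsm : ∀ (f g : WithConv (H →ₗ[k] k)) (a b : A),
      toConv (f.ofConv.smulRight a) * toConv (g.ofConv.smulRight b)
        = toConv ((f * g).ofConv.smulRight (a * b)) := by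
    intro f g a b
    ext h
    simp only [LinearMap.convMul_apply, LinearMap.smulRight_apply]
    induction Coalgebra.comul (R := k) h using TensorProduct.induction_on with
    | zero => simp
    | tmul x y => simp [mul_smul, smul_comm (g.ofConv y)]
    | add x y hx hy => simp only [map_add, hx, hy, add_smul]
  have hn1 : n ∈ S 1 := by
    let D := coradical k H
    let nb : (H ⧸ D) →ₗ[k] A := D.liftQ n.ofConv (fun c hc => hn c hc)
    let b := Module.finBasis k (H ⧸ D)
    have : n = ∑ j, toConv ((b.coord j ∘ₗ D.mkQ).smulRight (nb (b j))) := by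
      ext h
      have h1 : n h = nb (D.mkQ h) := rfl
      have h2 : nb (D.mkQ h) = ∑ j, b.repr (D.mkQ h) j • nb (b j) := by
        conv_lhs => rw [← b.sum_repr (D.mkQ h), map_sum]
        simp only [map_smul]
      rw [h1, h2]
      simp
    rw [this]
    refine Submodule.sum_mem _ fun j _ => Submodule.subset_span
      ⟨toConv (b.coord j ∘ₗ D.mkQ), ?_, _, rfl⟩
    rw [Submodule.pow_one]
    apply az_I_le
    intro V hV v hv
    have : D.mkQ v = 0 := by
      rw [Submodule.mkQ_apply, Submodule.Quotient.mk_eq_zero]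
      exact le_sSup (a := V) hV hv
    change b.coord j (D.mkQ v) = 0
    rw [this, map_zero]
  have hpow : ∀ i, n ^ (i + 1) ∈ S (i + 1) := by
    intro i
    induction i with
    | zero => simpa using hn1
    | succ i ih =>
      rw [pow_succ]
      have key : ∀ x ∈ S (i+1), ∀ y ∈ S 1, x * y ∈ S (i + 1 + 1) := by
        intro x hx y hy
        induction hx using Submodule.span_induction with
        | zero => simp
        | add _ _ _ _ h1 h2 => rw [add_mul]; exact add_mem h1 h2
        | smul c _ _ h1 => rw [smul_mul_assoc]; exact Submodule.smul_mem _ _ h1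
        | mem x hx =>
          obtain ⟨f, hf, a, rfl⟩ := hx
          induction hy using Submodule.span_induction with
          | zero => simp
          | add _ _ _ _ h1 h2 => rw [mul_add]; exact add_mem h1 h2
          | smul c _ _ h1 => rw [mul_smul_comm]; exact Submodule.smul_mem _ _ h1
          | mem y hy =>
            obtain ⟨g, hg, b, rfl⟩ := hy
            rw [hsm]
            refine Submodule.subset_span ⟨f * g, ?_, _, rfl⟩
            rw [Submodule.pow_succ]
            exact Ideal.mul_mem_mul hf (by rwa [Submodule.pow_one] at hg)
      exact key _ ih _ hn1
  refine ⟨N + 1, ?_⟩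
  have h := hpow N
  have h0 : S (N + 1) = ⊥ := by
    rw [eq_bot_iff]
    refine Submodule.span_le.mpr ?_
    rintro _ ⟨f, hf, a, rfl⟩
    rw [Submodule.pow_succ, hN] at hf
    have : f = 0 := by simpa using hf
    subst this
    ext; simp
  rw [h0] at h
  simpa using h
end AzHelpers
section AzMain
open WithConv

variable {k H A : Type} [Field k] [Ring H] [HopfAlgebra k H] [Ring A] [Algebra k A]

theorem az_iota_mul_apply (a : A) (φ : WithConv (H →ₗ[k] A)) (h : H) :
    (toConv ((Coalgebra.counit (R := k) (A := H)).smulRight a) * φ) h = a * φ h := by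
  have : LinearMap.mul' k A ∘ₗ
      TensorProduct.map ((Coalgebra.counit (R := k) (A := H)).smulRight a) φ.ofConv =
      LinearMap.mulLeft k a ∘ₗ φ.ofConv ∘ₗ (TensorProduct.lid k H).toLinearMap ∘ₗ
        LinearMap.rTensor H (Coalgebra.counit (R := k) (A := H)) := by
    ext x y; simp
  have h2 := LinearMap.congr_fun this (Coalgebra.comul (R := k) h)
  rw [LinearMap.convMul_apply]
  simp only [LinearMap.comp_apply, Coalgebra.rTensor_counit_comul] at h2
  rw [h2]; simp

theorem az_mul_iota_apply (a : A) (φ : WithConv (H →ₗ[k] A)) (h : H) :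
    (φ * toConv ((Coalgebra.counit (R := k) (A := H)).smulRight a)) h = φ h * a := by
  have : LinearMap.mul' k A ∘ₗ
      TensorProduct.map φ.ofConv ((Coalgebra.counit (R := k) (A := H)).smulRight a) =
      LinearMap.mulRight k a ∘ₗ φ.ofConv ∘ₗ (TensorProduct.rid k H).toLinearMap ∘ₗ
        LinearMap.lTensor H (Coalgebra.counit (R := k) (A := H)) := by
    ext x y; simp
  have h2 := LinearMap.congr_fun this (Coalgebra.comul (R := k) h)
  rw [LinearMap.convMul_apply]
  simp only [LinearMap.comp_apply, Coalgebra.lTensor_counit_comul] at h2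
  rw [h2]; simp

/-- the constant embedding -/
noncomputable def azι (k H A : Type) [Field k] [Ring H] [HopfAlgebra k H] [Ring A] [Algebra k A] :
    A →ₐ[k] WithConv (H →ₗ[k] A) :=
  AlgHom.ofLinearMap
    { toFun := fun a => toConv ((Coalgebra.counit (R := k) (A := H)).smulRight a)
      map_add' := fun a b => by ext; simp
      map_smul' := fun c a => by ext; simp [smul_comm c] }
    (by ext h; simp [Algebra.algebraMap_eq_smul_one])
    (fun a b => by
      ext h
      refine Eq.trans ?_ (az_iota_mul_apply a _ h).symm
      simp)

/-- the coaction -/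
noncomputable def azρ (ha : HopfAction k H A) : A →ₐ[k] WithConv (H →ₗ[k] A) :=
  AlgHom.ofLinearMap
    { toFun := fun a => toConv ((ha.act.toLinearMap : H →ₗ[k] A →ₗ[k] A).flip a)
      map_add' := fun a b => by ext; simp
      map_smul' := fun c a => by ext; simp }
    (by ext h; simp [ha.act_one, Algebra.algebraMap_eq_smul_one])
    (fun a b => by
      ext h
      exact ha.act_mul h a b)

theorem azρ_apply (ha : HopfAction k H A) (a : A) (h : H) : azρ ha a h = ha.act h a := rfl

theorem azι_apply (a : A) (h : H) : azι k H A a h = Coalgebra.counit (R := k) h • a := rfl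

theorem azι_mul (a : A) (φ : WithConv (H →ₗ[k] A)) (h : H) : (azι k H A a * φ) h = a * φ h :=
  az_iota_mul_apply a φ h

theorem az_mul_ι (a : A) (φ : WithConv (H →ₗ[k] A)) (h : H) : (φ * azι k H A a) h = φ h * a :=
  az_mul_iota_apply a φ h

theorem azι_comm {a : A} (hac : ∀ x, a * x = x * a) (φ : WithConv (H →ₗ[k] A)) :
    azι k H A a * φ = φ * azι k H A a := by
  ext h
  change (azι k H A a * φ) h = (φ * azι k H A a) h
  rw [azι_mul, az_mul_ι, hac]

theorem az_smul_mem (L : Ideal A) (c : k) {x : A} (hx : x ∈ L) : c • x ∈ L := by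
  rw [Algebra.smul_def]; exact L.mul_mem_left _ hx

theorem az_conv_mem_left (L : Ideal A) (χ ψ : WithConv (H →ₗ[k] A)) (hψ : ∀ h, ψ h ∈ L) (h : H) :
    (χ * ψ) h ∈ L := by
  rw [LinearMap.convMul_apply]
  induction Coalgebra.comul (R := k) h using TensorProduct.induction_on with
  | zero => simp
  | tmul x y => simpa using L.mul_mem_left _ (hψ y)
  | add x y hx hy => rw [map_add, map_add]; exact add_mem hx hy

theorem az_conv_mem_right (L : Ideal A) (φ : WithConv (H →ₗ[k] A)) (f : H →ₗ[k] k)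
    (hφ : ∀ h, φ h ∈ L) (h : H) :
    (φ * toConv (f.smulRight (1 : A))) h ∈ L := by
  rw [LinearMap.convMul_apply]
  induction Coalgebra.comul (R := k) h using TensorProduct.induction_on with
  | zero => simp
  | tmul x y => simpa using az_smul_mem L _ (hφ x)
  | add x y hx hy => rw [map_add, map_add]; exact add_mem hx hy

theorem az_iota_decomp [FiniteDimensional k H] (ha : HopfAction k H A) (d : A) :
    azι k H A d = ∑ j, azρ ha (ha.act (HopfAlgebra.antipode k (Module.finBasis k H j)) d) *
      toConv (((Module.finBasis k H).coord j).smulRight (1 : A)) := by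
  set b := Module.finBasis k H
  ext h
  have key : ∀ t : H ⊗[k] H,
      ∑ j, LinearMap.mul' k A (TensorProduct.map
        (azρ ha (ha.act (HopfAlgebra.antipode k (b j)) d)).ofConv ((b.coord j).smulRight (1 : A)) t) =
      ha.act (LinearMap.mul' k H (LinearMap.lTensor H (HopfAlgebra.antipode k) t)) d := by
    intro t
    induction t using TensorProduct.induction_on with
    | zero => simp
    | add x y hx hy => simp only [map_add, Finset.sum_add_distrib, hx, hy, LinearMap.add_apply]
    | tmul x y =>
      have e : ha.act x (ha.act (HopfAlgebra.antipode k y) d) =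
          ∑ j, b.repr y j • ha.act x (ha.act (HopfAlgebra.antipode k (b j)) d) := by
        conv_lhs => rw [← b.sum_repr y]
        simp only [map_sum, map_smul, LinearMap.sum_apply, LinearMap.smul_apply]
      simp [azρ_apply, e]
  have h2 := key (Coalgebra.comul (R := k) h)
  rw [HopfAlgebra.mul_antipode_lTensor_comul_apply] at h2
  simp only [WithConv.ofConv_sum, LinearMap.sum_apply, LinearMap.convMul_apply]
  rw [h2, azι_apply]
  simp [Algebra.algebraMap_eq_smul_one]

theorem az_right_stable [FiniteDimensional k H] (ha : HopfAction k H A)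
    (φ : WithConv (H →ₗ[k] A)) (hφ : ∀ d, φ * azρ ha d = azρ ha d * φ) (L : Ideal A)
    (hL : ∀ h, φ h ∈ L) (h : H) (d : A) : φ h * d ∈ L := by
  rw [← az_mul_ι, az_iota_decomp ha, Finset.mul_sum, WithConv.ofConv_sum, LinearMap.sum_apply]
  refine Submodule.sum_mem _ fun j _ => ?_
  rw [← mul_assoc, hφ, mul_assoc]
  exact az_conv_mem_left L _ _ (az_conv_mem_right L φ _ hL) h

/-- `μ_h (φ ⊗ ψ) = φ(h) ψ` -/
noncomputable def azμ (k : Type) {H A : Type} [Field k] [Ring H] [HopfAlgebra k H] [Ring A]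
    [Algebra k A] (h : H) :
    WithConv (H →ₗ[k] A) ⊗[k] WithConv (H →ₗ[k] A) →ₗ[k] WithConv (H →ₗ[k] A) :=
  TensorProduct.lift (LinearMap.mul k (WithConv (H →ₗ[k] A)) ∘ₗ (azι k H A).toLinearMap ∘ₗ
    LinearMap.applyₗ h ∘ₗ (WithConv.linearEquiv k (H →ₗ[k] A)).toLinearMap)

theorem azμ_tmul (h : H) (φ ψ : WithConv (H →ₗ[k] A)) :
    azμ k h (φ ⊗ₜ ψ) = azι k H A (φ h) * ψ := rfl

theorem azμ_mul_right (h : H) (t : WithConv (H →ₗ[k] A) ⊗[k] WithConv (H →ₗ[k] A))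
    (ψ : WithConv (H →ₗ[k] A)) : azμ k h (t * 1 ⊗ₜ ψ) = azμ k h t * ψ := by
  induction t using TensorProduct.induction_on with
  | zero => simp
  | add x y hx hy => simp only [add_mul, map_add, hx, hy]
  | tmul x y => simp [azμ_tmul, mul_assoc]

theorem azμ_iota (h : H) {a : A} (hac : ∀ x, a * x = x * a)
    (t : WithConv (H →ₗ[k] A) ⊗[k] WithConv (H →ₗ[k] A)) :
    azμ k h (t * (1 ⊗ₜ azι k H A a - azι k H A a ⊗ₜ 1)) = 0 := by
  induction t using TensorProduct.induction_on with
  | zero => simp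
  | add x y hx hy => simp only [add_mul, map_add, hx, hy, add_zero]
  | tmul x y =>
    rw [mul_sub, map_sub, Algebra.TensorProduct.tmul_mul_tmul, Algebra.TensorProduct.tmul_mul_tmul,
      azμ_tmul, azμ_tmul, mul_one, mul_one, az_mul_ι, map_mul, mul_assoc, azι_comm hac y, sub_self]

theorem azμ_pow (h : H) (u v : WithConv (H →ₗ[k] A) ⊗[k] WithConv (H →ₗ[k] A))
    (huv : Commute u v) (h0 : ∀ t, azμ k h (t * (u - v)) = 0) (m : ℕ) :
    ∀ t, azμ k h (t * u ^ m) = azμ k h (t * v ^ m) := by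
  induction m with
  | zero => simp
  | succ m ih =>
    intro t
    have h1 := h0 (t * u ^ m)
    rw [mul_sub, map_sub, sub_eq_zero] at h1
    rw [pow_succ, ← mul_assoc, h1, mul_assoc, (huv.pow_left m).eq, ← mul_assoc, ih, mul_assoc,
      ← pow_succ']

/-- `τ (x ⊗ y) = x ρ(y)` -/
noncomputable def azτ (ha : HopfAction k H A) : A ⊗[k] A →ₗ[k] WithConv (H →ₗ[k] A) :=
  LinearMap.mul' k _ ∘ₗ TensorProduct.map (azι k H A).toLinearMap (azρ ha).toLinearMap

theorem azτ_tmul (ha : HopfAction k H A) (x y : A) :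
    azτ ha (x ⊗ₜ y) = azι k H A x * azρ ha y := rfl

theorem azτ_pow (ha : HopfAction k H A) {a : A} (hac : ∀ x, a * x = x * a) (m : ℕ) :
    azτ ha ((1 ⊗ₜ a - a ⊗ₜ 1) ^ m) = (azρ ha a - azι k H A a) ^ m := by
  induction m with
  | zero => simp [Algebra.TensorProduct.one_def, azτ_tmul]
  | succ m ih =>
    rw [pow_succ, pow_succ, ← ih]
    generalize (1 ⊗ₜ a - a ⊗ₜ 1 : A ⊗[k] A) ^ m = t
    induction t using TensorProduct.induction_on with
    | zero => simp
    | add x y hx hy => simp only [add_mul, map_add, hx, hy]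
    | tmul x y =>
      rw [mul_sub, map_sub, Algebra.TensorProduct.tmul_mul_tmul,
        Algebra.TensorProduct.tmul_mul_tmul, mul_one, mul_one, azτ_tmul, azτ_tmul, azτ_tmul,
        map_mul, map_mul, mul_sub]
      congr 1
      · rw [mul_assoc]
      · rw [mul_assoc, mul_assoc, azι_comm hac]

theorem az_galois (h' h : H) :
    h' ⊗ₜ[k] h ∈ Submodule.span k
      {t : H ⊗[k] H | ∃ u g, t = Coalgebra.comul (R := k) u * (1 ⊗ₜ[k] g)} := by
  let G : H ⊗[k] H →ₗ[k] H ⊗[k] H :=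
    LinearMap.mul' k (H ⊗[k] H) ∘ₗ TensorProduct.map (Coalgebra.comul (R := k))
      (TensorProduct.mk k H H 1 ∘ₗ HopfAlgebra.antipode k)
  have hG : ∀ u v, G (u ⊗ₜ v) = Coalgebra.comul (R := k) u * (1 ⊗ₜ[k] HopfAlgebra.antipode k v) :=
    fun u v => rfl
  have e1 : G = LinearMap.lTensor H (LinearMap.mul' k H ∘ₗ
      LinearMap.lTensor H (HopfAlgebra.antipode k)) ∘ₗ (TensorProduct.assoc k H H H).toLinearMap ∘ₗ
      LinearMap.rTensor H (Coalgebra.comul (R := k)) := by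
    ext u v
    simp only [TensorProduct.AlgebraTensorModule.curry_apply, TensorProduct.curry_apply,
      LinearMap.coe_restrictScalars, LinearMap.comp_apply, hG, LinearMap.rTensor_tmul]
    induction Coalgebra.comul (R := k) u using TensorProduct.induction_on with
    | zero => simp
    | add x y hx hy => simp only [add_mul, TensorProduct.add_tmul, map_add, hx, hy]
    | tmul x y => simp
  have e2 : G (Coalgebra.comul (R := k) h') = h' ⊗ₜ 1 := by
    rw [e1]
    simp only [LinearMap.comp_apply, LinearEquiv.coe_coe, Coalgebra.coassoc_apply]
    rw [← LinearMap.comp_apply, ← LinearMap.lTensor_comp, LinearMap.comp_assoc,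
      HopfAlgebra.mul_antipode_lTensor_comul, LinearMap.lTensor_comp, LinearMap.comp_apply,
      Coalgebra.lTensor_counit_comul]
    simp
  have e3 : h' ⊗ₜ[k] h = G (Coalgebra.comul (R := k) h') * (1 ⊗ₜ h) := by
    rw [e2]; simp
  rw [e3]
  induction Coalgebra.comul (R := k) h' using TensorProduct.induction_on with
  | zero => simp
  | add x y hx hy => rw [map_add, add_mul]; exact add_mem hx hy
  | tmul x y =>
    refine Submodule.subset_span ⟨x, HopfAlgebra.antipode k y * h, ?_⟩
    rw [hG, mul_assoc, Algebra.TensorProduct.tmul_mul_tmul, one_mul]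

theorem az_tau_mu (ha : HopfAction k H A) (t : A ⊗[k] A) (ht : azτ ha t = 0) (h' : H) :
    azμ k h' (Algebra.TensorProduct.map (azρ ha) (azρ ha) t) = 0 := by
  let P : H ⊗[k] H →ₗ[k] A ⊗[k] A →ₗ[k] A := 
    (LinearMap.llcomp k (A ⊗[k] A) (A ⊗[k] A) A (LinearMap.mul' k A)) ∘ₗ
      (TensorProduct.homTensorHomMap (RingHom.id k) A A A A) ∘ₗ
      TensorProduct.map ha.act.toLinearMap ha.act.toLinearMap
  have hP : ∀ u g x y, P (u ⊗ₜ g) (x ⊗ₜ y) = ha.act u x * ha.act g y := fun u g x y => rfl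
  have e1 : ∀ h, azμ k h' (Algebra.TensorProduct.map (azρ ha) (azρ ha) t) h = P (h' ⊗ₜ h) t := by
    intro h
    clear ht
    induction t using TensorProduct.induction_on with
    | zero => simp
    | add x y hx hy => simp only [map_add, ← hx, ← hy, WithConv.ofConv_add, LinearMap.add_apply]
    | tmul x y => 
      rw [hP, Algebra.TensorProduct.map_tmul, azμ_tmul, azι_mul]; rfl
  have e2 : ∀ u g, P (Coalgebra.comul (R := k) u * (1 ⊗ₜ[k] g)) t = ha.act u (azτ ha t g) := by
    intro u g
    clear ht e1
    induction t using TensorProduct.induction_on with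
    | zero => simp
    | add x y hx hy => simp only [map_add, hx, hy, WithConv.ofConv_add, LinearMap.add_apply]
    | tmul x y =>
      rw [azτ_tmul, azι_mul, azρ_apply, ha.act_mul]
      induction Coalgebra.comul (R := k) u using TensorProduct.induction_on with
      | zero => simp
      | add v w hv hw => simp only [add_mul, map_add, hv, hw, LinearMap.add_apply]
      | tmul v w =>
        rw [Algebra.TensorProduct.tmul_mul_tmul, hP, mul_one, map_mul]; rfl
  have e3 : ∀ s : H ⊗[k] H, s ∈ Submodule.span k
      {t : H ⊗[k] H | ∃ u g, t = Coalgebra.comul (R := k) u * (1 ⊗ₜ[k] g)} → P s t = 0 := by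
    intro s hs
    induction hs using Submodule.span_induction with
    | zero => simp
    | add _ _ _ _ h1 h2 => simp [h1, h2]
    | smul c _ _ h1 => simp [h1]
    | mem x hx =>
      obtain ⟨u, g, rfl⟩ := hx
      rw [e2, ht]; simp
  ext h
  exact (e1 h).trans (e3 _ (az_galois h' h))

theorem az_binom {R : Type*} [Ring R] {x y : R} (h : Commute x y) (j : ℕ) :
    ∃ q, (x + y) ^ (j + 1) = y ^ (j + 1) + (j + 1 : ℕ) • (x * y ^ j) + x ^ 2 * q := by
  induction j with
  | zero => exact ⟨0, by simp [add_comm]⟩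
  | succ j ih =>
    obtain ⟨q, hq⟩ := ih
    refine ⟨(j + 1 : ℕ) • y ^ j + q * (x + y), ?_⟩
    have e : y ^ (j + 1) * x = x * y ^ (j + 1) := (h.symm.pow_left (j+1)).eq
    have e' : y ^ j * x = x * y ^ j := (h.symm.pow_left j).eq
    rw [pow_succ, hq]
    simp only [mul_add, add_mul, e, smul_mul_assoc, mul_assoc, e', mul_smul_comm, pow_two]
    rw [← pow_succ, ← pow_succ, succ_nsmul (x * y ^ (j+1)) (j+1)]
    abel

theorem az_gen {R M : Type*} [Ring R] [AddCommGroup M] {x y : R} (h : Commute x y) (m : ℕ)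
    (hx : x ^ (m + 2) = 0) (hy : y ^ (m + 2) = 0) (f : R →+ M)
    (hf : f ((x - y) ^ (m + 2) * x ^ m) = 0) :
    (m + 2 : ℕ) • f (x ^ (m + 1) * y ^ (m + 1)) = 0 := by
  obtain ⟨q, hq⟩ := az_binom h.neg_right (m + 1)
  have hy2 : (-y) ^ (m + 2) = 0 := by rw [neg_pow, hy, mul_zero]
  have hcc : Commute (x + -y) x := (Commute.refl _).add_left h.neg_right.symm
  rw [sub_eq_add_neg, (hcc.pow_pow _ _).eq, hq, hy2, zero_add, mul_add, ← mul_assoc,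
    ← pow_add, hx, zero_mul, add_zero, mul_smul_comm, ← mul_assoc, ← pow_succ, map_nsmul,
    neg_pow] at hf
  rcases neg_one_pow_eq_or R (m + 1) with h | h
  · rwa [h, one_mul] at hf
  · rwa [h, neg_mul, one_mul, mul_neg, map_neg, smul_neg, neg_eq_zero] at hf

theorem az_main [CharZero k] [FiniteDimensional k H] (ha : HopfAction k H A)
    (hA : ∀ L : Ideal A, (∀ x ∈ L, ∀ d, x * d ∈ L) → (∀ x ∈ L, ∀ y ∈ L, x * y = 0) → L = ⊥)
    {a : A} (hac : ∀ x, a * x = x * a) (hn : IsNilpotent (azρ ha a - azι k H A a)) :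
    azρ ha a - azι k H A a = 0 := by
  set n := azρ ha a - azι k H A a with hndef
  obtain ⟨m, hm, hmin⟩ : ∃ m, n ^ m = 0 ∧ ∀ i < m, n ^ i ≠ 0 := by
    classical
    exact ⟨Nat.find hn, Nat.find_spec hn, fun i hi => Nat.find_min hn hi⟩
  match m, hm, hmin with
  | 0, hm, _ => 
    rw [pow_zero] at hm
    rw [← one_mul n, hm, zero_mul]
  | 1, hm, _ => simpa using hm
  | m + 2, hm, hmin =>
    exfalso
    set φ := n ^ (m + 1) with hφ
    have hWW : ∀ h' h, φ h' * φ h = 0 := by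
      intro h' h
      have h1 := az_tau_mu ha ((1 ⊗ₜ[k] a - a ⊗ₜ[k] 1) ^ (m+2))
        (by rw [azτ_pow ha hac, ← hndef, hm]) h'
      simp only [map_pow, map_sub, Algebra.TensorProduct.map_tmul, map_one] at h1
      have hcn : Commute (azρ ha a) n := by
        refine Commute.sub_right rfl ?_
        exact (azι_comm hac _).symm
      have hcom : Commute ((1 : WithConv (H →ₗ[k] A)) ⊗ₜ[k] azρ ha a - azρ ha a ⊗ₜ[k] 1)
          (1 ⊗ₜ[k] n - n ⊗ₜ[k] 1) := by
        have := hcn.eq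
        simp only [Commute, SemiconjBy, mul_sub, sub_mul, Algebra.TensorProduct.tmul_mul_tmul,
          one_mul, mul_one, this]
        abel
      have h2 := azμ_pow h' _ _ hcom (fun t => by
        rw [← azμ_iota h' hac t]
        congr 2
        simp only [hndef, TensorProduct.tmul_sub, TensorProduct.sub_tmul]
        abel) (m + 2) 1
      rw [one_mul, one_mul, h1] at h2
      have h3 := azμ_mul_right h' ((1 ⊗ₜ[k] n - n ⊗ₜ[k] 1) ^ (m + 2)) (n ^ m)
      rw [← h2, zero_mul] at h3
      have hc : Commute ((1 : WithConv (H →ₗ[k] A)) ⊗ₜ[k] n) (n ⊗ₜ[k] 1) := by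
        simp [Commute, SemiconjBy]
      have hx (i : ℕ) : ((1 : WithConv (H →ₗ[k] A)) ⊗ₜ[k] n) ^ i = 1 ⊗ₜ[k] (n ^ i) := by
        rw [Algebra.TensorProduct.tmul_pow, one_pow]
      have hy (i : ℕ) : (n ⊗ₜ[k] (1 : WithConv (H →ₗ[k] A))) ^ i = (n ^ i) ⊗ₜ[k] 1 := by
        rw [Algebra.TensorProduct.tmul_pow, one_pow]
      have h4 := az_gen hc m (by rw [hx, hm, TensorProduct.tmul_zero])
        (by rw [hy, hm, TensorProduct.zero_tmul]) (azμ k h').toAddMonoidHom (by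
          rw [hx]; exact h3)
      rw [hx, hy, Algebra.TensorProduct.tmul_mul_tmul, one_mul, mul_one] at h4
      have h6 : azμ k h' (φ ⊗ₜ[k] φ) = 0 := by
        rw [← Nat.cast_smul_eq_nsmul k] at h4
        rcases smul_eq_zero.mp h4 with h | h
        · exact absurd h (by exact_mod_cast (by omega : m + 2 ≠ 0))
        · exact h
      rw [azμ_tmul] at h6
      rw [← azι_mul, h6]
      rfl
    have hcomm : ∀ d, φ * azρ ha d = azρ ha d * φ := by
      intro d
      have : Commute n (azρ ha d) := by
        refine Commute.sub_left ?_ (azι_comm hac _)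
        change _ * _ = _ * _
        rw [← map_mul, ← map_mul, hac]
      exact (this.pow_left _).eq
    let L : Ideal A := Ideal.span (Set.range φ)
    have hL : ∀ h, φ h ∈ L := fun h => Ideal.subset_span ⟨h, rfl⟩
    have hR : ∀ x ∈ L, ∀ d, x * d ∈ L := by
      intro x hx d
      induction hx using Submodule.span_induction with
      | zero => simp
      | add _ _ _ _ h1 h2 => rw [add_mul]; exact add_mem h1 h2
      | smul c _ _ h1 => rw [smul_eq_mul, mul_assoc]; exact L.mul_mem_left _ h1
      | mem x hx =>
        obtain ⟨h, rfl⟩ := hx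
        exact az_right_stable ha φ hcomm L hL h d
    have hLW : ∀ x ∈ L, ∀ h, x * φ h = 0 := by
      intro x hx h
      induction hx using Submodule.span_induction with
      | zero => simp
      | add _ _ _ _ h1 h2 => rw [add_mul, h1, h2, add_zero]
      | smul c _ _ h1 => rw [smul_eq_mul, mul_assoc, h1, mul_zero]
      | mem x hx =>
        obtain ⟨h0, rfl⟩ := hx
        exact hWW h0 h
    have hLL : ∀ x ∈ L, ∀ y ∈ L, x * y = 0 := by
      intro x hx y hy
      induction hy using Submodule.span_induction generalizing x with
      | zero => simp
      | add _ _ _ _ h1 h2 => rw [mul_add, h1 x hx, h2 x hx, add_zero]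
      | smul c _ _ h1 => rw [smul_eq_mul, ← mul_assoc, h1 _ (hR x hx c)]
      | mem y hy =>
        obtain ⟨h, rfl⟩ := hy
        exact hLW x hx h
    have hbot := hA L hR hLL
    refine hmin (m + 1) (by omega) ?_
    ext h
    have := hL h
    rw [hbot] at this
    simpa using this

theorem az_azumaya_ideal (Z : Type) [CommRing Z] [IsDomain Z] [Algebra Z A]
    (hZinj : Function.Injective (algebraMap Z A)) [Module.Projective Z A]
    (hAz : Function.Surjective (azumayaMap Z A)) (L : Ideal A) (hR : ∀ x ∈ L, ∀ d, x * d ∈ L)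
    (hLL : ∀ x ∈ L, ∀ y ∈ L, x * y = 0) : L = ⊥ := by
  by_contra hne
  obtain ⟨x, hx, hx0⟩ := Submodule.exists_mem_ne_zero_of_ne_bot hne
  obtain ⟨f, hf⟩ := Module.Projective.exists_dual_ne_zero Z hx0
  have hst : ∀ t : A ⊗[Z] Aᵐᵒᵖ, azumayaMap Z A t x ∈ L := by
    intro t
    induction t using TensorProduct.induction_on with
    | zero => simp
    | add s t hs ht => rw [map_add]; exact add_mem hs ht
    | tmul a b => exact L.mul_mem_left _ (hR x hx _)
  obtain ⟨t, ht⟩ := hAz (f.smulRight (1 : A))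
  have h1 := hst t
  rw [ht, LinearMap.smulRight_apply] at h1
  have h2 := hLL _ h1 _ h1
  rw [← Algebra.algebraMap_eq_smul_one, ← map_mul] at h2
  have := hZinj (h2.trans (map_zero _).symm)
  exact hf (by simpa using this)

theorem az_grouplike_counit {g : H} (hg : IsGrouplike k g) : Coalgebra.counit (R := k) g = 1 := by
  have h := Coalgebra.rTensor_counit_comul (R := k) g
  rw [hg.2] at h
  have h3 := congrArg (TensorProduct.lid k H) h
  simp only [LinearMap.rTensor_tmul, TensorProduct.lid_tmul, one_smul] at h3
  have : (Coalgebra.counit (R := k) g - 1) • g = 0 := by rw [sub_smul, h3, one_smul, sub_self]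
  rcases smul_eq_zero.mp this with h | h
  · exact sub_eq_zero.mp h
  · exact absurd h hg.1

end AzMain

/-- **Statement 12.** Let `H` be a finite dimensional Hopf algebra over `k` acting on an
Azumaya algebra `A` whose center `Z` is an integral domain.  Then:
(i) `Z^H = Z^{H₀}` where `H₀` is the coradical of `H`;
(ii) if moreover `H` is pointed with group of grouplikes `G = G(H)`, then `Z^H = Z^G`. -/
theorem azumaya_center_invariants
    (k : Type) [Field k] [IsAlgClosed k] [CharZero k]
    (H : Type) [Ring H] [HopfAlgebra k H] [FiniteDimensional k H]
    (A : Type) [Ring A] [Algebra k A]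
    (Z : Type) [CommRing Z] [IsDomain Z] [Algebra k Z] [Algebra Z A] [IsScalarTower k Z A]
    (hZinj : Function.Injective (algebraMap Z A))
    (hZcenter : Set.range (algebraMap Z A) = (Subring.center A : Set A))
    [Module.Finite Z A] [Module.Projective Z A] [FaithfulSMul Z A]
    (hAzumaya : Function.Bijective (azumayaMap Z A))
    (ha : HopfAction k H A) :
    ({a : A | a ∈ Set.range (algebraMap Z A) ∧ a ∈ ha.invariants} =
      {a : A | a ∈ Set.range (algebraMap Z A) ∧
        ∀ c ∈ coradical k H, ha.act c a = Coalgebra.counit (R := k) c • a}) ∧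
    (IsPointedHopf k H →
      {a : A | a ∈ Set.range (algebraMap Z A) ∧ a ∈ ha.invariants} =
        {a : A | a ∈ Set.range (algebraMap Z A) ∧
          ∀ g : H, IsGrouplike k g → ha.act g a = a}) := by
  have main : ∀ a ∈ Set.range (algebraMap Z A),
      (∀ c ∈ coradical k H, ha.act c a = Coalgebra.counit (R := k) c • a) →
      a ∈ ha.invariants := by
    rintro _ ⟨z, rfl⟩ hz h
    have hn := az_nilp (azρ ha (algebraMap Z A z) - azι k H A (algebraMap Z A z)) (by
      intro c hc
      exact sub_eq_zero.mpr (hz c hc))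
    have h0 := az_main ha (az_azumaya_ideal Z hZinj hAzumaya.surjective)
      (fun x => Algebra.commutes z x) hn
    have h1 := sub_eq_zero.mp h0
    have h2 := LinearMap.congr_fun (congrArg WithConv.ofConv h1) h
    exact h2
  refine ⟨?_, fun hp => ?_⟩
  · ext a
    exact ⟨fun h => ⟨h.1, fun c _ => h.2 c⟩, fun h => ⟨h.1, main a h.1 h.2⟩⟩
  · ext a
    constructor
    · intro h
      refine ⟨h.1, fun g hg => ?_⟩
      rw [h.2 g, az_grouplike_counit hg, one_smul]
    · intro h
      refine ⟨h.1, main a h.1 ?_⟩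
      intro c hc
      rw [hp] at hc
      induction hc using Submodule.span_induction with
      | zero => simp
      | add x y _ _ hx hy => simp only [map_add, LinearMap.add_apply, hx, hy, add_smul]
      | smul r x _ hx => simp only [map_smul, LinearMap.smul_apply, hx, smul_assoc]
      | mem g hg => rw [h.2 g hg, az_grouplike_counit hg, one_smul]
end

section
/- The Taft algebra T(n) is Galois-theoretical. Moreover, the fields L ⊇ k admitting an inner faithful T(n)-action are precisely those of the form L = F[u]/(uⁿ − v), where F = L^{T(n)} is the invariant subfield, u satisfies g·u = ζ^{-1}u, and v = uⁿ ∈ F^× is not an n'-th power in F for any divisor n' > 1 of n; after rescaling u one has x·u = 1, while g·r₀ = r₀ and x·r₀ = 0 for all r₀ ∈ F. In particular, L is a cyclic degree-n Galois extension of F with Galois group ℤ_n. -/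
open TensorProduct

/-- A witness that a field `F ⊇ k` together with an element `v ∈ F^×` which is not an `n'`-th
power for any divisor `n' > 1` of `n` gives rise to an inner faithful module field
`L = F[u]/(uⁿ - v)` for the Taft algebra `T` (with generators `g`, `x`). -/
structure TaftExtensionWitness (k T : Type) [Field k] [Ring T] [HopfAlgebra k T]
    (g x : T) (n : ℕ) (ζ : k) (F : Type) [Field F] [Algebra k F] (v : F) : Type 1 where
  L : Type
  [fieldL : Field L]
  [algL : Algebra k L]
  emb : F →ₐ[k] L
  action : HopfAction k T L
  faithful : InnerFaithful k action.act.toLinearMap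
  u : L
  u_pow : u ^ n = emb v
  act_g_u : action.act g u = ζ⁻¹ • u
  act_x_u : action.act x u = 1
  inv_eq : Set.range ⇑emb = action.invariants
  gen : Algebra.adjoin k (Set.range ⇑emb ∪ {u}) = ⊤


section

theorem taft_span {k A : Type} [Field k] [Ring A] [Algebra k A] {n : ℕ} (hn : 2 ≤ n) {ζ : k}
    {g x : A} (hgn : g ^ n = 1) (hxn : x ^ n = 0) (hgx : g * x = ζ • (x * g)) :
    Subalgebra.toSubmodule (Algebra.adjoin k {g, x}) ≤
      Submodule.span k (Set.range (fun p : Fin n × Fin n => x ^ (p.1 : ℕ) * g ^ (p.2 : ℕ))) := by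
  set S := Submodule.span k (Set.range (fun p : Fin n × Fin n => x ^ (p.1 : ℕ) * g ^ (p.2 : ℕ)))
  have hS : ∀ i j : ℕ, x ^ i * g ^ j ∈ S := by
    intro i j
    by_cases hi : i < n
    · have h1 : g ^ j = g ^ (j % n) := by
        conv_lhs => rw [← Nat.div_add_mod j n, pow_add, pow_mul, hgn, one_pow, one_mul]
      rw [h1]
      exact Submodule.subset_span ⟨(⟨i, hi⟩, ⟨j % n, Nat.mod_lt _ (by omega)⟩), rfl⟩
    · have : x ^ i = 0 := pow_eq_zero_of_le (by omega) hxn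
      rw [this, zero_mul]; exact S.zero_mem
  have hgxi : ∀ i : ℕ, g * x ^ i = ζ ^ i • (x ^ i * g) := by
    intro i
    induction i with
    | zero => simp
    | succ i ih =>
      rw [pow_succ, ← mul_assoc, ih, smul_mul_assoc, mul_assoc, hgx, mul_smul_comm, smul_smul,
        mul_assoc, pow_succ]
  have hmul : ∀ a ∈ Algebra.adjoin k {g, x}, ∀ s ∈ S, a * s ∈ S := by
    intro a ha
    induction ha using Algebra.adjoin_induction with
    | mem a ha =>
      intro s hs
      induction hs using Submodule.span_induction with
      | mem s hs =>
        obtain ⟨p, rfl⟩ := hs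
        rcases ha with rfl | rfl
        · dsimp only
          rw [← mul_assoc, hgxi, smul_mul_assoc, mul_assoc, ← pow_succ']
          exact S.smul_mem _ (hS _ _)
        · dsimp only
          rw [← mul_assoc, ← pow_succ']
          exact hS _ _
      | zero => simp
      | add s t _ _ h1 h2 => rw [mul_add]; exact S.add_mem h1 h2
      | smul c s _ h => rw [mul_smul_comm]; exact S.smul_mem _ h
    | algebraMap r =>
      intro s hs
      rw [← Algebra.smul_def]; exact S.smul_mem _ hs
    | add a b _ _ h1 h2 => intro s hs; rw [add_mul]; exact S.add_mem (h1 s hs) (h2 s hs)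
    | mul a b _ _ h1 h2 => intro s hs; rw [mul_assoc]; exact h1 _ (h2 s hs)
  intro a ha
  have := hmul a ha 1 (by simpa using hS 0 0)
  simpa using this

theorem taft_li {k T : Type} [Field k] [Ring T] [Algebra k T] {n : ℕ} (hn : 2 ≤ n) {ζ : k}
    {g x : T} (hgn : g ^ n = 1) (hxn : x ^ n = 0) (hgx : g * x = ζ • (x * g))
    (hgen : Algebra.adjoin k {g, x} = ⊤) (hdim : Module.finrank k T = n ^ 2) :
    LinearIndependent k (fun p : Fin n × Fin n => x ^ (p.1 : ℕ) * g ^ (p.2 : ℕ)) ∧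
    ⊤ ≤ Submodule.span k (Set.range (fun p : Fin n × Fin n => x ^ (p.1 : ℕ) * g ^ (p.2 : ℕ))) := by
  have h := taft_span hn hgn hxn hgx
  rw [hgen] at h
  have h' : ⊤ ≤ Submodule.span k
    (Set.range (fun p : Fin n × Fin n => x ^ (p.1 : ℕ) * g ^ (p.2 : ℕ))) := by simpa using h
  exact ⟨linearIndependent_of_top_le_span_of_card_eq_finrank h'
    (by rw [hdim]; simp [sq]), h'⟩

theorem taft_lift {k T A : Type} [Field k] [Ring T] [Algebra k T] [Ring A] [Algebra k A]
    {n : ℕ} (hn : 2 ≤ n) {ζ : k}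
    {g x : T} (hgn : g ^ n = 1) (hxn : x ^ n = 0) (hgx : g * x = ζ • (x * g))
    (hgen : Algebra.adjoin k {g, x} = ⊤) (hdim : Module.finrank k T = n ^ 2)
    {G X : A} (hGn : G ^ n = 1) (hXn : X ^ n = 0) (hGX : G * X = ζ • (X * G)) :
    ∃ φ : T →ₐ[k] A, φ g = G ∧ φ x = X := by
  let S : Subalgebra k (T × A) := Algebra.adjoin k {(g, G), (x, X)}
  let π : S →ₐ[k] T := (AlgHom.fst k T A).comp S.val
  have hspan := taft_span (k := k) (A := T × A) (ζ := ζ) (g := (g, G)) (x := (x, X)) hn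
    (by ext <;> simp [hgn, hGn]) (by ext <;> simp [hxn, hXn]) (by ext <;> simp [hgx, hGX])
  have hsurj : Function.Surjective π := by
    rw [← AlgHom.range_eq_top, eq_top_iff, ← hgen, Algebra.adjoin_le_iff]
    rintro a (rfl | rfl)
    · exact ⟨⟨(a, G), Algebra.subset_adjoin (by simp)⟩, rfl⟩
    · exact ⟨⟨(a, X), Algebra.subset_adjoin (by simp)⟩, rfl⟩
  have hT : FiniteDimensional k T := Module.finite_of_finrank_pos (by rw [hdim]; positivity)
  have hfin : (Set.range (fun p : Fin n × Fin n => ((x, X) : T × A) ^ (p.1 : ℕ) * (g, G) ^ (p.2 : ℕ))).Finite :=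
    Set.finite_range _
  have hfd := FiniteDimensional.span_of_finite k hfin
  have hle : Module.finrank k S ≤ n ^ 2 := by
    refine (Submodule.finrank_mono hspan).trans ?_
    refine (finrank_range_le_card _).trans ?_
    simp [sq]
  have hSfd : FiniteDimensional k S := Submodule.finiteDimensional_of_le hspan
  have heq : Module.finrank k S = Module.finrank k T := by
    apply le_antisymm (by rw [hdim]; exact hle)
    exact LinearMap.finrank_le_finrank_of_surjective (f := π.toLinearMap) hsurj
  have hinj : Function.Injective π :=
    (LinearMap.injective_iff_surjective_of_finrank_eq_finrank (f := π.toLinearMap) heq).2 hsurj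
  let e := AlgEquiv.ofBijective π ⟨hinj, hsurj⟩
  refine ⟨((AlgHom.snd k T A).comp S.val).comp e.symm.toAlgHom, ?_, ?_⟩
  · have : e.symm g = ⟨(g, G), Algebra.subset_adjoin (by simp)⟩ := by
      rw [AlgEquiv.symm_apply_eq]; rfl
    simp [this]
  · have : e.symm x = ⟨(x, X), Algebra.subset_adjoin (by simp)⟩ := by
      rw [AlgEquiv.symm_apply_eq]; rfl
    simp [this]


end

section

section
variable {k T : Type} [Field k] [Ring T] [HopfAlgebra k T]

theorem counit_grouplike {g : T} (hg : IsGrouplike k g) : Coalgebra.counit (R := k) g = 1 := by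
  have h := Coalgebra.rTensor_counit_comul (R := k) g
  rw [hg.2] at h
  simp only [LinearMap.rTensor_tmul] at h
  have h2 := congrArg (TensorProduct.lid k T) h
  simp only [TensorProduct.lid_tmul, one_smul] at h2
  have h3 : (Coalgebra.counit (R := k) g - 1) • g = 0 := by rw [sub_smul, h2, one_smul, sub_self]
  rcases smul_eq_zero.1 h3 with h | h
  · exact sub_eq_zero.1 h
  · exact absurd h hg.1

theorem counit_skew {g x : T} (hg : IsGrouplike k g)
    (hx : Coalgebra.comul (R := k) x = g ⊗ₜ[k] x + x ⊗ₜ[k] (1 : T)) :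
    Coalgebra.counit (R := k) x = 0 := by
  have h := Coalgebra.rTensor_counit_comul (R := k) x
  rw [hx] at h
  simp only [LinearMap.rTensor_tmul, map_add] at h
  have h2 := congrArg (TensorProduct.lid k T) h
  simp only [TensorProduct.lid_tmul, one_smul, map_add, counit_grouplike hg] at h2
  have h3 : Coalgebra.counit (R := k) x • (1 : T) = 0 := by simpa using h2
  rcases smul_eq_zero.1 h3 with h | h
  · exact h
  · exact absurd (by rw [← mul_one g, h, mul_zero]) hg.1

theorem antipode_skew {g x : T} (hg : IsGrouplike k g)
    (hx : Coalgebra.comul (R := k) x = g ⊗ₜ[k] x + x ⊗ₜ[k] (1 : T)) :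
    HopfAlgebra.antipode k x = - (HopfAlgebra.antipode k g * x) := by
  have h := HopfAlgebra.mul_antipode_rTensor_comul_apply (R := k) x
  rw [hx, counit_skew hg hx] at h
  simp at h
  exact eq_neg_of_add_eq_zero_right h

/-- the Hopf ideal generated by `x` -/
noncomputable def xIdeal {ζ : k} (hζ : ζ ≠ 0) {g x : T} (hg : IsGrouplike k g)
    (hx : Coalgebra.comul (R := k) x = g ⊗ₜ[k] x + x ⊗ₜ[k] (1 : T))
    (hgx : g * x = ζ • (x * g)) (hgen : Algebra.adjoin k {g, x} = ⊤) : HopfIdeal k T where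
  carrier := LinearMap.range (LinearMap.mulRight k x)
  mul_mem_left := by
    rintro a _ ⟨b, rfl⟩
    exact ⟨a * b, by simp [mul_assoc]⟩
  mul_mem_right := by
    have key : ∀ b : T, ∃ c, x * b = c * x := by
      intro b
      have hb : b ∈ Algebra.adjoin k {g, x} := by rw [hgen]; trivial
      induction hb using Algebra.adjoin_induction with
      | mem b hb =>
        rcases hb with rfl | rfl
        · exact ⟨ζ⁻¹ • b, by rw [smul_mul_assoc, hgx, smul_smul, inv_mul_cancel₀ hζ, one_smul]⟩
        · exact ⟨b, rfl⟩
      | algebraMap r => exact ⟨algebraMap k T r, (Algebra.commutes r x).symm⟩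
      | add a b _ _ h1 h2 =>
        obtain ⟨c, hc⟩ := h1
        obtain ⟨d, hd⟩ := h2
        exact ⟨c + d, by rw [mul_add, add_mul, hc, hd]⟩
      | mul a b _ _ h1 h2 =>
        obtain ⟨c, hc⟩ := h1
        obtain ⟨d, hd⟩ := h2
        exact ⟨c * d, by rw [← mul_assoc, hc, mul_assoc, hd, mul_assoc]⟩
    rintro a _ ⟨b, rfl⟩
    obtain ⟨c, hc⟩ := key a
    exact ⟨b * c, by simp [mul_assoc, hc]⟩
  comul_mem := by
    rintro _ ⟨a, rfl⟩
    rw [LinearMap.mulRight_apply, Bialgebra.comul_mul, hx]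
    generalize Coalgebra.comul (R := k) a = t
    induction t with
    | zero => simp
    | add s t h1 h2 => rw [add_mul]; exact Submodule.add_mem _ h1 h2
    | tmul p q =>
      rw [mul_add, Algebra.TensorProduct.tmul_mul_tmul, Algebra.TensorProduct.tmul_mul_tmul, add_comm]
      refine Submodule.add_mem_sup ?_ ?_
      · exact ⟨⟨p * x, p, rfl⟩ ⊗ₜ (q * 1), by simp⟩
      · exact ⟨(p * g) ⊗ₜ ⟨q * x, q, rfl⟩, by simp⟩
  counit_eq_zero := by
    rintro _ ⟨a, rfl⟩
    simp [counit_skew hg hx]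
  antipode_mem := by
    have key : ∀ b : T, ∃ c, x * b = c * x := by
      intro b
      have hb : b ∈ Algebra.adjoin k {g, x} := by rw [hgen]; trivial
      induction hb using Algebra.adjoin_induction with
      | mem b hb =>
        rcases hb with rfl | rfl
        · exact ⟨ζ⁻¹ • b, by rw [smul_mul_assoc, hgx, smul_smul, inv_mul_cancel₀ hζ, one_smul]⟩
        · exact ⟨b, rfl⟩
      | algebraMap r => exact ⟨algebraMap k T r, (Algebra.commutes r x).symm⟩
      | add a b _ _ h1 h2 =>
        obtain ⟨c, hc⟩ := h1
        obtain ⟨d, hd⟩ := h2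
        exact ⟨c + d, by rw [mul_add, add_mul, hc, hd]⟩
      | mul a b _ _ h1 h2 =>
        obtain ⟨c, hc⟩ := h1
        obtain ⟨d, hd⟩ := h2
        exact ⟨c * d, by rw [← mul_assoc, hc, mul_assoc, hd, mul_assoc]⟩
    rintro _ ⟨a, rfl⟩
    obtain ⟨c, hc⟩ := key (HopfAlgebra.antipode k a)
    refine ⟨- (HopfAlgebra.antipode k g * c), ?_⟩
    rw [LinearMap.mulRight_apply, LinearMap.mulRight_apply, HopfAlgebra.antipode_mul_antidistrib,
      antipode_skew hg hx, neg_mul, neg_mul, mul_assoc, mul_assoc, hc]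

section action
variable {A : Type} [CommRing A] [Algebra k A]

/-- `a b`-evaluation on a tensor. -/
noncomputable def evT (φ : T →ₐ[k] Module.End k A) (a b : A) : T ⊗[k] T →ₗ[k] A :=
  LinearMap.mul' k A ∘ₗ
      (TensorProduct.map ((φ.toLinearMap : T →ₗ[k] A →ₗ[k] A).flip a)
        ((φ.toLinearMap : T →ₗ[k] A →ₗ[k] A).flip b))

theorem evT_tmul (φ : T →ₐ[k] Module.End k A) (a b : A) (p q : T) :
    evT φ a b (p ⊗ₜ q) = φ p a * φ q b := by
  simp [evT]

theorem evT_mul (φ : T →ₐ[k] Module.End k A) (a b : A) (t : T ⊗[k] T) (p q : T) :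
    evT φ a b (t * p ⊗ₜ q) = evT φ (φ p a) (φ q b) t := by
  induction t with
  | zero => simp
  | add s t h1 h2 => rw [add_mul, map_add, map_add, h1, h2]
  | tmul r s => simp [evT_tmul]

/-- build an action from its values on generators -/
theorem action_of_gens {g x : T} (hg : IsGrouplike k g)
    (hx : Coalgebra.comul (R := k) x = g ⊗ₜ[k] x + x ⊗ₜ[k] (1 : T))
    (hgen : Algebra.adjoin k {g, x} = ⊤)
    (φ : T →ₐ[k] Module.End k A)
    (h1 : ∀ a b, φ g (a * b) = φ g a * φ g b)
    (h2 : ∀ a b, φ x (a * b) = φ g a * φ x b + φ x a * b)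
    (h3 : φ g 1 = 1) (h4 : φ x 1 = 0) : ∃ ha : HopfAction k T A, ha.act = φ := by
  refine ⟨⟨φ, ?_, ?_⟩, rfl⟩
  · intro h
    suffices H : ∀ a b, φ h (a * b) = evT φ a b (Coalgebra.comul (R := k) h) from H
    have hh : h ∈ Algebra.adjoin k {g, x} := by rw [hgen]; trivial
    induction hh using Algebra.adjoin_induction with
    | mem h hh =>
      rcases hh with rfl | rfl
      · intro a b; rw [hg.2, evT_tmul, h1]
      · intro a b; rw [hx, map_add, evT_tmul, evT_tmul, h2]; simp
    | algebraMap r =>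
      intro a b
      rw [Bialgebra.comul_algebraMap, Algebra.TensorProduct.algebraMap_apply, evT_tmul]
      simp [Algebra.smul_def, mul_assoc]
    | add p q _ _ hp hq => intro a b; simp [hp, hq]
    | mul p q _ _ hp hq =>
      intro a b
      rw [Bialgebra.comul_mul, map_mul φ, Module.End.mul_apply, hq]
      generalize Coalgebra.comul (R := k) q = t
      induction t with
      | zero => simp
      | add s t h1 h2 => rw [map_add, map_add, h1, h2, mul_add, map_add]
      | tmul r s => rw [evT_mul, evT_tmul, hp]
  · intro h
    have hh : h ∈ Algebra.adjoin k {g, x} := by rw [hgen]; trivial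
    induction hh using Algebra.adjoin_induction with
    | mem h hh =>
      rcases hh with rfl | rfl
      · rw [h3, counit_grouplike hg, one_smul]
      · rw [h4, counit_skew hg hx, zero_smul]
    | algebraMap r => simp 
    | add p q _ _ hp hq => simp [hp, hq, add_smul]
    | mul p q _ _ hp hq => simp [hp, hq, smul_smul, mul_comm]

end action
end

end

section

section
variable {k T : Type} [Field k] [Ring T] [HopfAlgebra k T]
variable {L : Type} [Field L] [Algebra k L]

theorem act_g_mul {g : T} (hg : IsGrouplike k g) (ha : HopfAction k T L) (a b : L) :
    ha.act g (a * b) = ha.act g a * ha.act g b := by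
  rw [ha.act_mul, hg.2]; simp

theorem act_x_mul {g x : T}
    (hx : Coalgebra.comul (R := k) x = g ⊗ₜ[k] x + x ⊗ₜ[k] (1 : T)) (ha : HopfAction k T L) (a b : L) :
    ha.act x (a * b) = ha.act g a * ha.act x b + ha.act x a * b := by
  rw [ha.act_mul, hx]; simp

theorem act_x_pow {ζ : k} {g x : T}
    (hg : IsGrouplike k g)
    (hx : Coalgebra.comul (R := k) x = g ⊗ₜ[k] x + x ⊗ₜ[k] (1 : T)) (ha : HopfAction k T L)
    (u : L) (hgu : ha.act g u = ζ⁻¹ • u) (hxu : ha.act x u = 1) (m : ℕ) :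
    ha.act x (u ^ (m + 1)) = (∑ i ∈ Finset.range (m + 1), (ζ⁻¹) ^ i) • u ^ m := by
  induction m with
  | zero => simp [hxu]
  | succ m ih =>
    rw [pow_succ', act_x_mul hx, ih, hgu, hxu, one_mul, Finset.sum_range_succ' _ (m + 1),
      Finset.sum_congr rfl (fun i _ => pow_succ' ζ⁻¹ i), ← Finset.mul_sum, smul_mul_assoc,
      mul_smul_comm, smul_smul, ← pow_succ', add_smul, pow_zero, one_smul]

theorem geom_ne_zero {ζ : k} {n : ℕ} (hζ : IsPrimitiveRoot ζ n) {m : ℕ} (hm : m + 1 < n) :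
    (∑ i ∈ Finset.range (m + 1), (ζ⁻¹) ^ i) ≠ 0 := by
  intro h
  have h1 := geom_sum_mul ζ⁻¹ (m + 1)
  rw [h, zero_mul] at h1
  exact hζ.inv.pow_ne_one_of_pos_of_lt (by omega) hm (sub_eq_zero.1 h1.symm)

theorem act_xpow_upow {ζ : k} {n : ℕ} (hζ : IsPrimitiveRoot ζ n) {g x : T}
    (hg : IsGrouplike k g)
    (hx : Coalgebra.comul (R := k) x = g ⊗ₜ[k] x + x ⊗ₜ[k] (1 : T)) (ha : HopfAction k T L)
    (u : L) (hgu : ha.act g u = ζ⁻¹ • u) (hxu : ha.act x u = 1) (m : ℕ) (hm : m < n) :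
    ∃ c : k, c ≠ 0 ∧ ha.act (x ^ m) (u ^ m) = c • 1 := by
  induction m with
  | zero => exact ⟨1, one_ne_zero, by simp⟩
  | succ m ih =>
    obtain ⟨c, hc, h⟩ := ih (by omega)
    refine ⟨(∑ i ∈ Finset.range (m + 1), (ζ⁻¹) ^ i) * c, mul_ne_zero (geom_ne_zero hζ hm) hc, ?_⟩
    rw [pow_succ x, map_mul ha.act, Module.End.mul_apply, act_x_pow hg hx ha u hgu hxu, map_smul, h,
      smul_smul]

theorem taft_innerFaithful [IsAlgClosed k] {n : ℕ} (hn : 2 ≤ n) {ζ : k} (hζ : IsPrimitiveRoot ζ n)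
    {g x : T} (hg : IsGrouplike k g)
    (hx : Coalgebra.comul (R := k) x = g ⊗ₜ[k] x + x ⊗ₜ[k] (1 : T))
    (hgn : g ^ n = 1) (hxn : x ^ n = 0) (hgx : g * x = ζ • (x * g))
    (hgen : Algebra.adjoin k {g, x} = ⊤)
    (hdim : Module.finrank k T = n ^ 2) (ha : HopfAction k T L)
    (u : L) (hgu : ha.act g u = ζ⁻¹ • u) (hxu : ha.act x u = 1) :
    InnerFaithful k ha.act.toLinearMap := by
  intro I hI
  replace hI : ∀ h ∈ I.carrier, ha.act h = 0 := hI
  have hT : FiniteDimensional k T := Module.finite_of_finrank_pos (by rw [hdim]; positivity)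
  have hζ1 : ζ⁻¹ ≠ 1 := hζ.inv.ne_one (by omega)
  have hu0 : u ≠ 0 := by
    rintro rfl
    simp at hxu
  obtain ⟨χ, hχg, hχx⟩ := taft_lift (A := k) (G := ζ⁻¹) (X := 0) hn hgn hxn hgx hgen hdim
    hζ.inv.pow_eq_one (by rw [zero_pow (by omega)]) (by simp)
  have hχ : ∀ h : T, ∃ c : k, ha.act h u = χ h • u + c • 1 := by
    intro h
    have hh : h ∈ Algebra.adjoin k {g, x} := by rw [hgen]; trivial
    induction hh using Algebra.adjoin_induction with
    | mem h hh =>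
      rcases hh with rfl | rfl
      · exact ⟨0, by rw [hgu, hχg]; simp⟩
      · exact ⟨1, by rw [hxu, hχx]; simp⟩
    | algebraMap r => exact ⟨0, by simp⟩
    | add p q _ _ hp hq =>
      obtain ⟨c, hc⟩ := hp
      obtain ⟨d, hd⟩ := hq
      exact ⟨c + d, by rw [map_add, map_add, LinearMap.add_apply, hc, hd, add_smul, add_smul]; abel⟩
    | mul p q _ _ hp hq =>
      obtain ⟨c, hc⟩ := hp
      obtain ⟨d, hd⟩ := hq
      refine ⟨χ q * c + d * Coalgebra.counit (R := k) p, ?_⟩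
      rw [map_mul ha.act, Module.End.mul_apply, hd, map_add, map_smul, map_smul, hc, ha.act_one,
        map_mul, smul_add, smul_smul, smul_smul, smul_smul, add_smul, mul_comm (χ p), add_assoc]
  have hχI : ∀ h ∈ I.carrier, χ h = 0 := by
    intro h hh
    obtain ⟨c, hc⟩ := hχ h
    rw [hI h hh, LinearMap.zero_apply] at hc
    have h2 := congrArg (ha.act g) hc
    rw [map_zero, map_add, map_smul, map_smul, hgu, ha.act_one, counit_grouplike hg, one_smul] at h2
    have h3 : (χ h * (ζ⁻¹ - 1)) • u = 0 := by
      rw [mul_sub, sub_smul, mul_one, mul_smul]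
      linear_combination hc - h2
    rcases smul_eq_zero.1 h3 with h4 | h4
    · exact (mul_eq_zero.1 h4).resolve_right (sub_ne_zero.2 hζ1)
    · exact absurd h4 hu0
  -- the twisting
  let Θ : T ⊗[k] T →ₐ[k] T := Algebra.TensorProduct.lift (AlgHom.id k T) ((Algebra.ofId k T).comp χ)
    (fun a b => (Algebra.commutes (χ b) a).symm)
  have hΘ : ∀ p q : T, Θ (p ⊗ₜ q) = χ q • p := by
    intro p q
    refine (Algebra.TensorProduct.lift_tmul _ _ _ p q).trans ?_
    rw [Algebra.smul_def, Algebra.commutes]; rfl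
  let θ : T →ₐ[k] T := Θ.comp (Bialgebra.comulAlgHom k T)
  have hθg : θ g = ζ⁻¹ • g := by
    simp [θ, hΘ, hg.2, hχg]
  have hθx : θ x = x := by
    simp [θ, hΘ, hx, hχx]
  have hθI : ∀ h ∈ I.carrier, θ h ∈ I.carrier := by
    intro h hh
    have h1 : LinearMap.range (TensorProduct.map I.carrier.subtype (LinearMap.id (M := T))) ⊔
       LinearMap.range (TensorProduct.map (LinearMap.id (M := T)) I.carrier.subtype) ≤
       I.carrier.comap Θ.toLinearMap := by
      apply sup_le
      · rintro _ ⟨t, rfl⟩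
        induction t with
        | zero => simp
        | add s t h1 h2 => rw [map_add]; exact Submodule.add_mem _ h1 h2
        | tmul p q => 
          simpa [hΘ] using I.carrier.smul_mem _ p.2
      · rintro _ ⟨t, rfl⟩
        induction t with
        | zero => simp
        | add s t h1 h2 => rw [map_add]; exact Submodule.add_mem _ h1 h2
        | tmul p q => 
          simp [hΘ, hχI q q.2]
    exact h1 (I.comul_mem h hh)
  by_contra hne
  have hnt : Nontrivial I.carrier := Submodule.nontrivial_iff_ne_bot.2 hne
  obtain ⟨μ, hμ⟩ := Module.End.exists_eigenvalue (θ.toLinearMap.restrict hθI)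
  obtain ⟨⟨h, hhI⟩, hh⟩ := hμ.exists_hasEigenvector
  have hh0 : h ≠ 0 := fun e => hh.2 (by ext; exact e)
  have hhμ : θ h = μ • h := congrArg Subtype.val hh.apply_eq_smul
  obtain ⟨hli, hsp⟩ := taft_li hn hgn hxn hgx hgen hdim
  let b := Module.Basis.mk hli hsp
  have hb : ∀ p, b p = x ^ (p.1 : ℕ) * g ^ (p.2 : ℕ) := fun p => by simp [b]
  have hθb : ∀ p, θ (b p) = (ζ⁻¹) ^ (p.2 : ℕ) • b p := by
    intro p
    rw [hb, map_mul, map_pow, map_pow, hθg, hθx, smul_pow, mul_smul_comm]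
  have hrep : ∀ p, (ζ⁻¹) ^ (p.2 : ℕ) * b.repr h p = μ * b.repr h p := by
    intro p
    have e1 : θ h = ∑ q, ((ζ⁻¹) ^ (q.2 : ℕ) * b.repr h q) • b q := by
      conv_lhs => rw [← b.sum_repr h, map_sum]
      refine Finset.sum_congr rfl fun q _ => ?_
      rw [map_smul, hθb, smul_smul, mul_comm]
    have e2 : b.repr (θ h) p = (ζ⁻¹) ^ (p.2 : ℕ) * b.repr h p := by
      rw [e1, b.repr_sum_self]
    rw [← e2, hhμ]; simp
  have hex : ∃ p, b.repr h p ≠ 0 := by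
    by_contra hcon
    push Not at hcon
    exact hh0 (b.repr.map_eq_zero_iff.1 (Finsupp.ext hcon))
  obtain ⟨⟨i0, j0⟩, hp0⟩ := hex
  have hμ0 : μ = (ζ⁻¹) ^ (j0 : ℕ) := (mul_right_cancel₀ hp0 (hrep (i0, j0))).symm
  have hz : ∀ p, p.2 ≠ j0 → b.repr h p = 0 := by
    intro p hp
    by_contra hc
    have := mul_right_cancel₀ hc (hrep p)
    rw [hμ0] at this
    exact hp (Fin.ext (hζ.inv.pow_inj p.2.2 j0.2 this))
  have hsum : h = (∑ i, b.repr h (i, j0) • x ^ (i : ℕ)) * g ^ (j0 : ℕ) := by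
    conv_lhs => rw [← b.sum_repr h, Fintype.sum_prod_type]
    rw [Finset.sum_mul]
    refine Finset.sum_congr rfl fun i _ => ?_
    rw [Finset.sum_eq_single j0]
    · rw [hb, smul_mul_assoc]
    · intro j _ hj
      rw [hz (i, j) hj, zero_smul]
    · simp
  set y := ∑ i, b.repr h (i, j0) • x ^ (i : ℕ) with hy
  have hyI : y ∈ I.carrier := by
    have := I.mul_mem_right (g ^ (n - j0)) hhI
    rw [hsum, mul_assoc, ← pow_add, Nat.add_sub_cancel' j0.2.le, hgn, mul_one] at this
    exact this
  -- minimal index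
  classical
  let s : Finset (Fin n) := Finset.univ.filter fun i => b.repr h (i, j0) ≠ 0
  have hs : s.Nonempty := ⟨i0, by simp [s, hp0]⟩
  obtain ⟨m, hm, hmin⟩ := s.exists_min_image id hs
  have hm' : b.repr h (m, j0) ≠ 0 := by simpa [s] using hm
  have hxy : x ^ (n - 1 - m) * y = b.repr h (m, j0) • x ^ (n - 1) := by
    rw [hy, Finset.mul_sum, Finset.sum_eq_single m]
    · rw [mul_smul_comm, ← pow_add, Nat.sub_add_cancel (by omega)]
    · intro i _ hi
      by_cases h0 : b.repr h (i, j0) = 0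
      · rw [h0, zero_smul, mul_zero]
      · have : m ≤ i := hmin i (by simp [s, h0])
        have : m < i := lt_of_le_of_ne this (Ne.symm hi)
        rw [mul_smul_comm, ← pow_add, pow_eq_zero_of_le _ hxn, smul_zero]
        have : (m : ℕ) < i := this
        omega
    · simp
  obtain ⟨c, hc, hcu⟩ := act_xpow_upow hζ hg hx ha u hgu hxu (n - 1) (by omega)
  have h1 := hI _ (I.mul_mem_left (x ^ (n - 1 - m)) hyI)
  rw [hxy, map_smul] at h1
  have h2 := congrArg (fun f => f (u ^ (n - 1))) h1
  simp only [LinearMap.smul_apply, LinearMap.zero_apply, hcu, smul_smul] at h2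
  rcases smul_eq_zero.1 h2 with h3 | h3
  · exact mul_ne_zero hm' hc h3
  · exact one_ne_zero h3

end

end

section

section
variable {k L : Type} [Field k] [Field L] [Algebra k L]

theorem sigma_pow {σ : L ≃ₐ[k] L} {ζ : k} {u : L} (h : σ u = ζ⁻¹ • u) (m : ℕ) :
    (σ ^ m) u = (ζ⁻¹) ^ m • u := by
  induction m with
  | zero => simp
  | succ m ih => rw [pow_succ, AlgEquiv.mul_apply, h, map_smul, ih, smul_smul, pow_succ']

theorem sigma_upow {σ : L ≃ₐ[k] L} {ζ : k} {u : L} (h : σ u = ζ⁻¹ • u) (m : ℕ) :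
    σ (u ^ m) = (ζ⁻¹) ^ m • u ^ m := by
  rw [map_pow, h, smul_pow]

theorem kummer_part {n : ℕ} (hn : 2 ≤ n) {ζ : k} (hζ : IsPrimitiveRoot ζ n)
    (σ : L ≃ₐ[k] L) (hσn : σ ^ n = 1) (u : L) (hu0 : u ≠ 0) (hu : σ u = ζ⁻¹ • u)
    (F : IntermediateField k L) (hF : ∀ a, a ∈ F ↔ σ a = a) :
        u ^ n ∈ F ∧
        (∀ n' : ℕ, 1 < n' → n' ∣ n → ¬∃ w ∈ F, w ^ n' = u ^ n) ∧
        Algebra.adjoin (↥F) {u} = ⊤ ∧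
        IsGalois F L ∧ Module.finrank (↥F) L = n ∧
        Nonempty ((L ≃ₐ[F] L) ≃* Multiplicative (ZMod n)) := by
  have hpow : ∀ m, (σ ^ m) u = u → n ∣ m := by
    intro m hm
    rw [sigma_pow hu] at hm
    have h1 : ((ζ⁻¹) ^ m - 1) • u = 0 := by rw [sub_smul, hm, one_smul, sub_self]
    have h2 := (smul_eq_zero.1 h1).resolve_right hu0
    exact hζ.inv.dvd_of_pow_eq_one m (sub_eq_zero.1 h2)
  have hord : orderOf σ = n := by
    apply Nat.dvd_antisymm (orderOf_dvd_of_pow_eq_one hσn)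
    exact hpow _ (by rw [pow_orderOf_eq_one]; rfl)
  have hfix : ∀ a ∈ F, ∀ τ ∈ Subgroup.zpowers σ, τ a = a := by
    intro a ha τ hτ
    have h1 : Subgroup.zpowers σ ≤ MulAction.stabilizer (L ≃ₐ[k] L) a := by
      rw [Subgroup.zpowers_le]; exact (hF a).1 ha
    exact h1 hτ
  have hG : IsGaloisGroup (Subgroup.zpowers σ) F L :=
    { faithful := inferInstance
      commutes := ⟨fun τ a b => by
        rw [Algebra.smul_def, smul_mul', Algebra.smul_def]
        congr 1
        exact hfix a a.2 τ τ.2⟩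
      isInvariant := ⟨fun b hb => ⟨⟨b, (hF b).2 (hb ⟨σ, Subgroup.mem_zpowers σ⟩)⟩, rfl⟩⟩ }
  have hcard : Nat.card (Subgroup.zpowers σ) = n := by rw [Nat.card_zpowers, hord]
  have hfinG : Finite (Subgroup.zpowers σ) := Nat.finite_of_card_ne_zero (by omega)
  have hgal : IsGalois F L := IsGaloisGroup.isGalois (Subgroup.zpowers σ) F L
  have hfd : FiniteDimensional F L := IsGaloisGroup.finiteDimensional (Subgroup.zpowers σ) F L
  refine ⟨?_, ?_, ?_, hgal, ?_, ?_⟩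
  · rw [hF, sigma_upow hu, hζ.inv.pow_eq_one, one_smul]
  · rintro n' hn' ⟨m, rfl⟩ ⟨w, hwF, hw⟩
    have hprim : IsPrimitiveRoot (ζ ^ m) n' := hζ.pow (by omega) (mul_comm _ _)
    have hprimL : IsPrimitiveRoot (algebraMap k L (ζ ^ m)) n' :=
      hprim.map_of_injective (algebraMap k L).injective
    have hw0 : w ≠ 0 := by
      rintro rfl
      rw [zero_pow (by omega)] at hw
      exact pow_ne_zero _ hu0 hw.symm
    have hr : (u ^ m / w) ^ n' = 1 := by
      rw [div_pow, ← pow_mul, mul_comm m, hw, div_self (pow_ne_zero _ hu0)]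
    have : NeZero n' := ⟨by omega⟩
    obtain ⟨i, _, hi⟩ := hprimL.eq_pow_of_pow_eq_one hr
    have hum : u ^ m ∈ F := by
      have : u ^ m = algebraMap k L ((ζ ^ m) ^ i) * w := by
        rw [map_pow, hi, div_mul_cancel₀ _ hw0]
      rw [this]
      exact F.mul_mem (F.algebraMap_mem _) hwF
    rw [hF, sigma_upow hu] at hum
    have h1 : ((ζ⁻¹) ^ m - 1) • u ^ m = 0 := by rw [sub_smul, hum, one_smul, sub_self]
    have h2 := (smul_eq_zero.1 h1).resolve_right (pow_ne_zero _ hu0)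
    have h3 := hζ.inv.dvd_of_pow_eq_one m (sub_eq_zero.1 h2)
    have hm0 : 0 < m := by
      rcases Nat.eq_zero_or_pos m with rfl | h
      · omega
      · exact h
    have := Nat.le_of_dvd hm0 h3
    nlinarith
  · rw [← IntermediateField.adjoin_simple_toSubalgebra_of_isAlgebraic (IsAlgebraic.of_finite F u)]
    have : (IntermediateField.adjoin F {u}).fixingSubgroup = ⊥ := by
      rw [eq_bot_iff]
      intro τ hτ
      obtain ⟨⟨ρ, hρ⟩, rfl⟩ := (IsGaloisGroup.mulEquivAlgEquiv (Subgroup.zpowers σ) F L).surjective τ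
      have h1 : ρ u = u := by
        have := (IntermediateField.mem_fixingSubgroup_iff _ _).1 hτ u
          (IntermediateField.mem_adjoin_simple_self F u)
        exact this
      have hfo : IsOfFinOrder σ := isOfFinOrder_iff_pow_eq_one.2 ⟨n, by omega, hσn⟩
      obtain ⟨m, hm⟩ := hfo.mem_powers_iff_mem_zpowers.2 hρ
      obtain rfl : σ ^ m = ρ := hm
      have h2 : σ ^ m = 1 := orderOf_dvd_iff_pow_eq_one.1 (hord ▸ hpow m h1)
      rw [Subgroup.mem_bot]
      ext a
      change (σ ^ m) a = a
      rw [h2]; rfl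
    rw [← IsGalois.fixedField_fixingSubgroup (IntermediateField.adjoin F {u}), this,
      IntermediateField.fixedField_bot, IntermediateField.top_toSubalgebra]
  · rw [← IsGaloisGroup.card_eq_finrank (Subgroup.zpowers σ) F L, hcard]
  · have e := zmodCyclicMulEquiv (G := Subgroup.zpowers σ) inferInstance
    rw [hcard] at e
    exact ⟨(IsGaloisGroup.mulEquivAlgEquiv (Subgroup.zpowers σ) F L).symm.trans e.symm⟩

variable {T : Type} [Ring T] [HopfAlgebra k T]

theorem invariants_iff {g x : T} (hg : IsGrouplike k g)
    (hx : Coalgebra.comul (R := k) x = g ⊗ₜ[k] x + x ⊗ₜ[k] (1 : T))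
    (hgen : Algebra.adjoin k {g, x} = ⊤) (ha : HopfAction k T L) (a : L) :
    a ∈ ha.invariants ↔ ha.act g a = a ∧ ha.act x a = 0 := by
  constructor
  · intro h
    refine ⟨?_, ?_⟩
    · rw [h g, counit_grouplike hg, one_smul]
    · rw [h x, counit_skew hg hx, zero_smul]
  · rintro ⟨h1, h2⟩ h
    have hh : h ∈ Algebra.adjoin k {g, x} := by rw [hgen]; trivial
    induction hh using Algebra.adjoin_induction with
    | mem h hh =>
      rcases hh with rfl | rfl
      · rw [h1, counit_grouplike hg, one_smul]
      · rw [h2, counit_skew hg hx, zero_smul]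
    | algebraMap r => simp
    | add p q _ _ hp hq => simp [hp, hq, add_smul]
    | mul p q _ _ hp hq => simp [hp, hq, smul_smul, mul_comm]

theorem taft_forward {n : ℕ} (hn : 2 ≤ n) {ζ : k} (hζ : IsPrimitiveRoot ζ n)
    {g x : T} (hg : IsGrouplike k g)
    (hx : Coalgebra.comul (R := k) x = g ⊗ₜ[k] x + x ⊗ₜ[k] (1 : T))
    (hgn : g ^ n = 1) (hxn : x ^ n = 0) (hgx : g * x = ζ • (x * g))
    (hgen : Algebra.adjoin k {g, x} = ⊤)
    (hdim : Module.finrank k T = n ^ 2) (ha : HopfAction k T L)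
    (hif : InnerFaithful k ha.act.toLinearMap) :
      ∃ (F : IntermediateField k L) (u : L),
        (F : Set L) = ha.invariants ∧
        u ≠ 0 ∧
        ha.act g u = ζ⁻¹ • u ∧
        ha.act x u = 1 ∧
        (∀ r ∈ F, ha.act g r = r ∧ ha.act x r = 0) ∧
        u ^ n ∈ F ∧
        (∀ n' : ℕ, 1 < n' → n' ∣ n → ¬∃ w ∈ F, w ^ n' = u ^ n) ∧
        Algebra.adjoin (↥F) {u} = ⊤ ∧
        IsGalois F L ∧ Module.finrank (↥F) L = n ∧
        Nonempty ((L ≃ₐ[F] L) ≃* Multiplicative (ZMod n)) := by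
  have hζ0 : ζ ≠ 0 := hζ.ne_zero (by omega)
  have hζ1 : ζ ≠ 1 := hζ.ne_one (by omega)
  have hx0 : x ≠ 0 := by
    have h := (taft_li hn hgn hxn hgx hgen hdim).1.ne_zero (⟨1, by omega⟩, ⟨0, by omega⟩)
    simpa using h
  have hax : ha.act x ≠ 0 := by
    intro h0
    have h1 := hif (xIdeal hζ0 hg hx hgx hgen) (by
      rintro _ ⟨a, rfl⟩
      change ha.act (a * x) = 0
      rw [map_mul, h0, mul_zero])
    have h2 : x ∈ (xIdeal hζ0 hg hx hgx hgen).carrier := ⟨1, by simp⟩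
    rw [h1] at h2
    exact hx0 h2
  have hcom : ∀ a, ha.act g (ha.act x a) = ζ • ha.act x (ha.act g a) := by
    intro a
    have := congrArg (fun t => ha.act t a) hgx
    simpa using this
  obtain ⟨a0, ha0⟩ : ∃ a, ha.act x a ≠ 0 := by
    by_contra h
    push Not at h
    exact hax (LinearMap.ext h)
  obtain ⟨b, hb⟩ : ∃ b, ha.act g b ≠ b := by
    by_contra h
    push Not at h
    have h1 := hcom a0
    rw [h, h] at h1
    have h2 : (ζ - 1) • ha.act x a0 = 0 := by rw [sub_smul, ← h1, one_smul, sub_self]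
    exact (smul_ne_zero (sub_ne_zero.2 hζ1) ha0) h2
  have hb' : ha.act g b - b ≠ 0 := sub_ne_zero.2 hb
  set c : L := ha.act x b / (ha.act g b - b) with hc
  have hxc : ∀ a, ha.act x a = c * (ha.act g a - a) := by
    intro a
    have h1 := act_x_mul hx ha a b
    rw [mul_comm a b, act_x_mul hx ha b a] at h1
    rw [hc]
    field_simp
    linear_combination h1
  have hc0 : c ≠ 0 := by
    intro h
    rw [hxc, h, zero_mul] at ha0
    exact ha0 rfl
  -- sigma
  have hg1 : ha.act g 1 = 1 := by rw [ha.act_one, counit_grouplike hg, one_smul]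
  have hgm : ∀ a b, ha.act g (a * b) = ha.act g a * ha.act g b := act_g_mul hg ha
  let σ0 : L →ₐ[k] L := AlgHom.ofLinearMap (ha.act g) hg1 hgm
  have hσ0 : ∀ a, σ0 a = ha.act g a := fun _ => rfl
  have hsurj : Function.Surjective σ0 := by
    intro a
    refine ⟨ha.act (g ^ (n - 1)) a, ?_⟩
    rw [hσ0, ← Module.End.mul_apply, ← map_mul, ← pow_succ', Nat.sub_add_cancel (by omega), hgn]
    simp
  let σ : L ≃ₐ[k] L := AlgEquiv.ofBijective σ0 ⟨σ0.toRingHom.injective, hsurj⟩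
  have hσ : ∀ a, σ a = ha.act g a := fun _ => rfl
  have hσp : ∀ m a, (σ ^ m) a = ha.act (g ^ m) a := by
    intro m
    induction m with
    | zero => simp
    | succ m ih => intro a; rw [pow_succ, AlgEquiv.mul_apply, ih, hσ, pow_succ, map_mul]; rfl
  have hσn : σ ^ n = 1 := by
    ext a
    rw [hσp, hgn]; simp
  have hσc : σ c = ζ • c := by
    have h1 := hcom b
    rw [hxc, hxc (ha.act g b), ← hσ (c * _), map_mul, hσ (_ - _), ← map_sub, ← smul_mul_assoc] at h1
    refine mul_right_cancel₀ ?_ h1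
    rw [← hσ]
    exact (map_ne_zero σ).2 hb'
  have hd : ζ⁻¹ - 1 ≠ 0 := sub_ne_zero.2 (hζ.inv.ne_one (by omega))
  let u : L := (ζ⁻¹ - 1)⁻¹ • c⁻¹
  have hu0 : u ≠ 0 := smul_ne_zero (inv_ne_zero hd) (inv_ne_zero hc0)
  have hσu : σ u = ζ⁻¹ • u := by
    simp only [u]
    rw [map_smul, map_inv₀, hσc, smul_comm]
    congr 1
    rw [Algebra.smul_def, Algebra.smul_def, mul_inv, map_inv₀]
  have hxu : ha.act x u = 1 := by
    rw [hxc, ← hσ, hσu]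
    have : ζ⁻¹ • u - u = c⁻¹ := by
      have e : ζ⁻¹ • u - u = (ζ⁻¹ - 1) • u := by rw [sub_smul, one_smul]
      rw [e]
      simp only [u]
      rw [smul_smul, mul_inv_cancel₀ hd, one_smul]
    rw [this, mul_inv_cancel₀ hc0]
  have hinv : ∀ a, a ∈ ha.invariants ↔ σ a = a := by
    intro a
    rw [invariants_iff hg hx hgen, hσ]
    constructor
    · exact fun h => h.1
    · intro h; exact ⟨h, by rw [hxc, h, sub_self, mul_zero]⟩
  let F : IntermediateField k L := FixedPoints.intermediateField (Subgroup.zpowers σ)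
  have hF : ∀ a, a ∈ F ↔ σ a = a := by
    intro a
    refine FixedPoints.mem_intermediateField_iff.trans ⟨fun h => h ⟨σ, Subgroup.mem_zpowers σ⟩, ?_⟩
    rintro h ⟨τ, hτ⟩
    have h1 : Subgroup.zpowers σ ≤ MulAction.stabilizer (L ≃ₐ[k] L) a := by
      rw [Subgroup.zpowers_le]; exact h
    exact h1 hτ
  refine ⟨F, u, ?_, hu0, hσu, hxu, ?_, kummer_part hn hζ σ hσn u hu0 hσu F hF⟩
  · ext a
    rw [hinv, ← hF]; rfl
  · intro r hr
    rw [hF, ← hinv, invariants_iff hg hx hgen] at hr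
    exact hr

end

end

section

section
open Polynomial

theorem taft_irreducible {F : Type} [Field F] {n : ℕ} (hn : 2 ≤ n) {ζ : F}
    (hζ : IsPrimitiveRoot ζ n) (v : F) (hv : v ≠ 0)
    (h : ∀ n' : ℕ, 1 < n' → n' ∣ n → ¬∃ f : F, f ^ n' = v) : Irreducible (X ^ n - C v) := by
  let E := AlgebraicClosure F
  have hn0 : NeZero n := ⟨by omega⟩
  obtain ⟨u, hu⟩ := IsAlgClosed.exists_pow_nat_eq (algebraMap F E v) (n := n) (by omega)
  have hu0 : u ≠ 0 := by
    rintro rfl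
    rw [zero_pow (by omega)] at hu
    exact hv ((map_eq_zero (algebraMap F E)).1 hu.symm)
  have hint : IsIntegral F u := Algebra.IsIntegral.isIntegral u
  have hmonic : (X ^ n - C v).Monic := monic_X_pow_sub_C v (by omega)
  have hroot : aeval u (X ^ n - C v) = 0 := by simp [hu]
  have hdvd : minpoly F u ∣ X ^ n - C v := minpoly.dvd F u hroot
  have hζE : IsPrimitiveRoot (algebraMap F E ζ) n := hζ.map_of_injective (algebraMap F E).injective
  set d := (minpoly F u).natDegree with hd
  have hd0 : 0 < d := minpoly.natDegree_pos hint
  have hdn : d ≤ n := by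
    have := natDegree_le_of_dvd hdvd hmonic.ne_zero
    simpa using this
  by_cases hlt : d = n
  · have : minpoly F u = X ^ n - C v :=
      (eq_of_monic_of_dvd_of_natDegree_le (minpoly.monic hint) hmonic hdvd (by simp [← hd, hlt])).symm
    rw [← this]
    exact minpoly.irreducible hint
  exfalso
  -- roots of the minimal polynomial
  have hroots : ∀ z ∈ ((minpoly F u).map (algebraMap F E)).roots, ∃ i : ℕ, z = algebraMap F E (ζ ^ i) * u := by
    intro z hz
    have hz1 : aeval z (minpoly F u) = 0 := by
      have := (mem_roots'.1 hz).2
      rwa [IsRoot.def, eval_map_algebraMap] at this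
    have hz2 : aeval z (X ^ n - C v) = 0 := by
      obtain ⟨q, hq⟩ := hdvd
      rw [hq, map_mul, hz1, zero_mul]
    have hz3 : z ^ n = u ^ n := by
      rw [hu]; simpa [sub_eq_zero] using hz2
    have hz4 : (z / u) ^ n = 1 := by rw [div_pow, hz3, div_self (pow_ne_zero _ hu0)]
    obtain ⟨i, _, hi⟩ := hζE.eq_pow_of_pow_eq_one hz4
    exact ⟨i, by rw [map_pow, hi, div_mul_cancel₀ _ hu0]⟩
  have hprod : ∀ s : Multiset E, (∀ z ∈ s, ∃ i : ℕ, z = algebraMap F E (ζ ^ i) * u) →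
      ∃ j : ℕ, s.prod = algebraMap F E (ζ ^ j) * u ^ (Multiset.card s) := by
    intro s
    induction s using Multiset.induction with
    | empty => intro _; exact ⟨0, by simp⟩
    | cons a s ih =>
      intro hs
      obtain ⟨j, hj⟩ := ih (fun z hz => hs z (Multiset.mem_cons_of_mem hz))
      obtain ⟨i, hi⟩ := hs a (Multiset.mem_cons_self a s)
      refine ⟨i + j, ?_⟩
      rw [Multiset.prod_cons, hj, hi, Multiset.card_cons, pow_add, map_mul, pow_succ]
      ring
  obtain ⟨j, hj⟩ := hprod _ hroots
  have hsplit : ((minpoly F u).map (algebraMap F E)).Splits := IsAlgClosed.splits _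
  have hcard : Multiset.card ((minpoly F u).map (algebraMap F E)).roots = d := by
    rw [← hsplit.natDegree_eq_card_roots, natDegree_map]
  have hmm : ((minpoly F u).map (algebraMap F E)).Monic := (minpoly.monic hint).map _
  have hcoeff := hsplit.coeff_zero_eq_prod_roots_of_monic hmm
  rw [hj, hcard, coeff_map, natDegree_map] at hcoeff
  have hud : ∃ f : F, algebraMap F E f = u ^ d := by
    have h1 : ζ ^ j ≠ 0 := pow_ne_zero _ (hζ.ne_zero (by omega))
    refine ⟨(minpoly F u).coeff 0 * ((-1) ^ d * ζ ^ j)⁻¹, ?_⟩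
    have h2 : algebraMap F E ((-1) ^ d * ζ ^ j) ≠ 0 := by
      rw [_root_.map_ne_zero]; exact mul_ne_zero (pow_ne_zero _ (by simp)) h1
    rw [map_mul, map_inv₀, hcoeff, ← div_eq_mul_inv, div_eq_iff h2, ← hd]
    simp only [map_mul, map_pow, map_neg, map_one]
    ring
  -- the gcd
  have hgcd : (u ^ (Nat.gcd d n)) ∈ (algebraMap F E).fieldRange := by
    have h1 : u ^ d ∈ (algebraMap F E).fieldRange := hud
    have h2 : u ^ n ∈ (algebraMap F E).fieldRange := ⟨v, hu.symm⟩
    have h3 : u ^ (Nat.gcd d n) = (u ^ d) ^ (Nat.gcdA d n) * (u ^ n) ^ (Nat.gcdB d n) := by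
      rw [← zpow_natCast, Nat.gcd_eq_gcd_ab, zpow_add₀ hu0, zpow_mul, zpow_mul, zpow_natCast,
        zpow_natCast]
    rw [h3]
    exact mul_mem (zpow_mem h1 _) (zpow_mem h2 _)
  obtain ⟨f, hf⟩ := hgcd
  obtain ⟨q, hq⟩ := Nat.gcd_dvd_right d n
  have hgle : Nat.gcd d n ≤ d := Nat.le_of_dvd hd0 (Nat.gcd_dvd_left d n)
  refine h q ?_ ⟨_, by rw [mul_comm] at hq; exact hq⟩ ⟨f, ?_⟩
  · by_contra hq1
    have : q ≤ 1 := by omega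
    have := Nat.mul_le_mul_left (Nat.gcd d n) this
    omega
  · apply (algebraMap F E).injective
    rw [map_pow, ← hu]
    rw [show algebraMap F E f = u ^ Nat.gcd d n from hf, ← pow_mul, ← hq]

variable {k T : Type} [Field k] [Ring T] [HopfAlgebra k T]

theorem taft_converse [IsAlgClosed k] {n : ℕ} (hn : 2 ≤ n) {ζ : k} (hζ : IsPrimitiveRoot ζ n)
    {g x : T} (hg : IsGrouplike k g)
    (hx : Coalgebra.comul (R := k) x = g ⊗ₜ[k] x + x ⊗ₜ[k] (1 : T))
    (hgn : g ^ n = 1) (hxn : x ^ n = 0) (hgx : g * x = ζ • (x * g))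
    (hgen : Algebra.adjoin k {g, x} = ⊤)
    (hdim : Module.finrank k T = n ^ 2) (F : Type) [Field F] [Algebra k F] (v : F) (hv : v ≠ 0)
    (h : ∀ n' : ℕ, 1 < n' → n' ∣ n → ¬∃ f : F, f ^ n' = v) :
    Nonempty (TaftExtensionWitness k T g x n ζ F v) := by
  have hζF : IsPrimitiveRoot (algebraMap k F ζ) n := hζ.map_of_injective (algebraMap k F).injective
  have hirr := taft_irreducible hn hζF v hv h
  have hζ0 : ζ ≠ 0 := hζ.ne_zero (by omega)
  have hd : ζ⁻¹ - 1 ≠ 0 := sub_ne_zero.2 (hζ.inv.ne_one (by omega))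
  set P : F[X] := X ^ n - C v with hP
  have hfact : Fact (Irreducible P) := ⟨hirr⟩
  have hP0 : P ≠ 0 := hirr.ne_zero
  have hdeg : P.natDegree = n := by simp [hP]
  let L := AdjoinRoot P
  let u : L := AdjoinRoot.root P
  have hun : u ^ n = algebraMap F L v := by
    have h1 : aeval u (X ^ n - C v) = 0 := by
      change aeval u P = 0
      exact (AdjoinRoot.aeval_eq P).trans AdjoinRoot.mk_self
    rwa [map_sub, map_pow, aeval_X, aeval_C, sub_eq_zero] at h1
  have hu0 : u ≠ 0 := by
    intro h0
    rw [h0, zero_pow (by omega)] at hun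
    exact hv ((map_eq_zero (algebraMap F L)).1 hun.symm)
  have hσex : ∃ σ : L →ₐ[F] L, σ u = ζ⁻¹ • u := by
    refine ⟨AdjoinRoot.liftAlgHom P (Algebra.ofId F L) (ζ⁻¹ • u) ?_, ?_⟩
    · have : aeval (ζ⁻¹ • u) (X ^ n - C v) = 0 := by
        rw [map_sub, map_pow, aeval_X, aeval_C, _root_.smul_pow, hζ.inv.pow_eq_one, one_smul, hun,
          sub_self]
      exact this
    · exact AdjoinRoot.liftAlgHom_root P (Algebra.ofId F L) (ζ⁻¹ • u) _
  obtain ⟨σ, hσu⟩ := hσex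
  -- power basis
  obtain ⟨b, hb⟩ : ∃ b : Module.Basis (Fin n) F L, ∀ i, b i = u ^ (i : ℕ) := by
    let pb := AdjoinRoot.powerBasis hP0
    refine ⟨pb.basis.reindex (finCongr (by simp [pb, hdeg])), fun i => ?_⟩
    simp [pb, u]
  have hσup : ∀ m, σ (u ^ m) = ((algebraMap k F ζ)⁻¹) ^ m • u ^ m := by
    intro m
    rw [map_pow, hσu, _root_.smul_pow, ← map_inv₀, ← map_pow, algebraMap_smul]
  let s : L →ₗ[k] L := (σ.restrictScalars k).toLinearMap
  have hs : ∀ a, s a = σ a := fun _ => rfl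
  have hsk : ∀ (c : k) a, σ (c • a) = c • σ a := fun c a => s.map_smul c a
  let c : L := ((ζ⁻¹ - 1) • u)⁻¹
  have hw0 : (ζ⁻¹ - 1) • u ≠ 0 := smul_ne_zero hd hu0
  have hc0 : c ≠ 0 := inv_ne_zero hw0
  have hσc : σ c = ζ • c := by
    simp only [c]
    rw [map_inv₀, hsk, hσu, smul_comm, Algebra.smul_def, mul_inv, ← map_inv₀, inv_inv,
      ← Algebra.smul_def]
  let ξ : L →ₗ[k] L := (LinearMap.mulLeft k c) ∘ₗ (s - LinearMap.id)
  have hξ : ∀ a, ξ a = c * (σ a - a) := fun _ => rfl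
  have hξF : ∀ (f : F) a, ξ (f • a) = f • ξ a := by
    intro f a
    rw [hξ, hξ, map_smul, ← smul_sub, mul_smul_comm]
  have hξu : ∀ m, ∃ r : F, ξ (u ^ (m + 1)) = r • u ^ m := by
    intro m
    refine ⟨algebraMap k F ((ζ⁻¹ - 1)⁻¹ * ((ζ⁻¹) ^ (m + 1) - 1)), ?_⟩
    rw [hξ, map_pow, hσu, _root_.smul_pow, algebraMap_smul]
    have : c = (ζ⁻¹ - 1)⁻¹ • u⁻¹ := by
      simp only [c]
      rw [Algebra.smul_def, mul_inv, ← map_inv₀, ← Algebra.smul_def]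
    have e : (ζ⁻¹) ^ (m + 1) • u ^ (m + 1) - u ^ (m + 1) = ((ζ⁻¹) ^ (m + 1) - 1) • u ^ (m + 1) := by
      rw [sub_smul, one_smul]
    rw [this, e, smul_mul_smul_comm, pow_succ' u m, inv_mul_cancel_left₀ hu0]
  have hξ1 : ξ 1 = 0 := by rw [hξ, map_one, sub_self, mul_zero]
  have hξpow : ∀ m j, j < m → (ξ ^ m) (u ^ j) = 0 := by
    intro m
    induction m with
    | zero => intro j hj; omega
    | succ m ih =>
      intro j hj
      rw [pow_succ, Module.End.mul_apply]
      rcases j with _ | j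
      · rw [pow_zero, hξ1, map_zero]
      · obtain ⟨r, hr⟩ := hξu j
        rw [hr]
        have : ∀ (p : ℕ) (f : F) a, (ξ ^ p) (f • a) = f • (ξ ^ p) a := by
          intro p
          induction p with
          | zero => intro f a; simp
          | succ p ihp =>
            intro f a
            rw [pow_succ, Module.End.mul_apply, Module.End.mul_apply, hξF, ihp]
        rw [this, ih j (by omega), smul_zero]
  have hξpF : ∀ (p : ℕ) (f : F) a, (ξ ^ p) (f • a) = f • (ξ ^ p) a := by
    intro p
    induction p with
    | zero => intro f a; simp
    | succ p ihp =>
      intro f a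
      rw [pow_succ, Module.End.mul_apply, Module.End.mul_apply, hξF, ihp]
  have hξn : ξ ^ n = 0 := by
    ext a
    rw [← b.sum_repr a, map_sum]
    simp only [LinearMap.zero_apply]
    refine Finset.sum_eq_zero fun i _ => ?_
    rw [hξpF, hb, hξpow n i i.2, smul_zero]
  have hsp : ∀ (p : ℕ) (f : F) a, (s ^ p) (f • a) = f • (s ^ p) a := by
    intro p
    induction p with
    | zero => intro f a; simp
    | succ p ihp =>
      intro f a
      rw [pow_succ, Module.End.mul_apply, Module.End.mul_apply, hs, hs, map_smul, ihp]
  have hspu : ∀ (p j : ℕ), (s ^ p) (u ^ j) = (((algebraMap k F ζ)⁻¹) ^ j) ^ p • u ^ j := by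
    intro p j
    induction p with
    | zero => simp
    | succ p ih =>
      rw [pow_succ, Module.End.mul_apply, hs, hσup, hsp, ih, smul_smul, pow_succ']
  have hsn : s ^ n = 1 := by
    ext a
    rw [← b.sum_repr a, map_sum, Module.End.one_apply]
    refine Finset.sum_congr rfl fun i _ => ?_
    rw [hsp, hb, hspu, ← pow_mul, mul_comm, pow_mul, hζF.inv.pow_eq_one, one_pow, one_smul]
  have hsξ : s * ξ = ζ • (ξ * s) := by
    ext a
    rw [LinearMap.smul_apply, Module.End.mul_apply, Module.End.mul_apply, hs, hs, hξ, hξ, map_mul,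
      hσc, map_sub, smul_mul_assoc]
  obtain ⟨φ, hφg, hφx⟩ := taft_lift (A := Module.End k L) hn hgn hxn hgx hgen hdim hsn hξn hsξ
  obtain ⟨ha, hact⟩ := action_of_gens hg hx hgen φ
    (by intro a b; rw [hφg, hs, hs, hs, map_mul])
    (by intro a b; rw [hφg, hφx, hs, hξ, hξ, hξ, map_mul]; ring)
    (by rw [hφg, hs, map_one]) (by rw [hφx, hξ1])
  have hgu : ha.act g u = ζ⁻¹ • u := by rw [hact, hφg, hs, hσu]
  have hxu : ha.act x u = 1 := by
    rw [hact, hφx, hξ, hσu]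
    have e : ζ⁻¹ • u - u = (ζ⁻¹ - 1) • u := by rw [sub_smul, one_smul]
    rw [e]
    exact inv_mul_cancel₀ hw0
  refine ⟨{
    L := L
    emb := IsScalarTower.toAlgHom k F L
    action := ha
    faithful := taft_innerFaithful hn hζ hg hx hgn hxn hgx hgen hdim ha u hgu hxu
    u := u
    u_pow := hun
    act_g_u := hgu
    act_x_u := hxu
    inv_eq := ?_
    gen := ?_ }⟩
  · ext a
    rw [invariants_iff hg hx hgen, hact, hφg, hφx, hs, hξ]
    constructor
    · rintro ⟨f, rfl⟩
      have : σ (algebraMap F L f) = algebraMap F L f := σ.commutes f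
      simp [this]
    · rintro ⟨h1, -⟩
      have h2 : ∀ i : Fin n, ((algebraMap k F ζ)⁻¹) ^ (i : ℕ) * b.repr a i = b.repr a i := by
        intro i
        have e1 : σ a = ∑ q : Fin n, (((algebraMap k F ζ)⁻¹) ^ (q : ℕ) * b.repr a q) • b q := by
          conv_lhs => rw [← b.sum_repr a, map_sum]
          refine Finset.sum_congr rfl fun q _ => ?_
          rw [map_smul, hb, hσup, smul_smul, mul_comm]
        have e2 : b.repr (σ a) i = ((algebraMap k F ζ)⁻¹) ^ (i : ℕ) * b.repr a i := by
          rw [e1, b.repr_sum_self]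
        rw [← e2, h1]
      have h3 : ∀ i : Fin n, (i : ℕ) ≠ 0 → b.repr a i = 0 := by
        intro i hi
        by_contra hne
        exact hζF.inv.pow_ne_one_of_pos_of_lt hi i.2
          (mul_right_cancel₀ hne ((h2 i).trans (one_mul _).symm))
      refine ⟨b.repr a ⟨0, by omega⟩, ?_⟩
      change algebraMap F L _ = a
      conv_rhs => rw [← b.sum_repr a]
      rw [Finset.sum_eq_single (⟨0, by omega⟩ : Fin n)]
      · rw [hb, pow_zero, Algebra.smul_def, mul_one]
      · intro i _ hi
        rw [h3 i (fun h => hi (Fin.ext h)), zero_smul]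
      · simp
  · rw [eq_top_iff]
    rintro a -
    rw [← b.sum_repr a]
    refine sum_mem fun i _ => ?_
    rw [Algebra.smul_def, hb]
    refine mul_mem (Algebra.subset_adjoin (Or.inl ⟨_, rfl⟩)) (pow_mem ?_ _)
    exact Algebra.subset_adjoin (Or.inr rfl)

theorem ratfunc_not_pow {k : Type} [Field k] (n' : ℕ) (h : 1 < n') :
    ¬ ∃ f : RatFunc k, f ^ n' = RatFunc.X := by
  rintro ⟨f, hf⟩
  have hf0 : f ≠ 0 := by
    rintro rfl
    rw [zero_pow (by omega)] at hf
    exact RatFunc.X_ne_zero hf.symm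
  have hp : ∀ m : ℕ, RatFunc.intDegree (f ^ m) = m * RatFunc.intDegree f := by
    intro m
    induction m with
    | zero => simp
    | succ m ih =>
      rw [pow_succ, RatFunc.intDegree_mul (pow_ne_zero _ hf0) hf0, ih]
      push_cast; ring
  have h1 := hp n'
  rw [hf, RatFunc.intDegree_X] at h1
  have h2 : (n' : ℤ) ∣ 1 := ⟨_, h1⟩
  have h3 := Int.le_of_dvd one_pos h2
  omega

end

end

/-- **Statement 14.** The Taft algebra `T(n)` (presented by a grouplike `g` and a
`(g,1)`-skew primitive `x` with `gⁿ = 1`, `xⁿ = 0`, `gx = ζxg`, of dimension `n²`) is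
Galois-theoretical; the fields `L` admitting an inner faithful `T(n)`-action are precisely
those of the form `L = F[u]/(uⁿ - v)` with `F = L^{T(n)}`, `v = uⁿ ∈ F^×` not an `n'`-th power
in `F` for any divisor `n' > 1` of `n`; after rescaling `u` one has `g ⬝ u = ζ⁻¹ u`,
`x ⬝ u = 1`, and `g ⬝ r = r`, `x ⬝ r = 0` for `r ∈ F`.  In particular `L` is a cyclic degree-`n`
Galois extension of `F` with Galois group `ℤ_n`. -/
theorem taft_galoisTheoretical
    (k : Type) [Field k] [IsAlgClosed k] [CharZero k]
    (n : ℕ) (hn : 2 ≤ n) (ζ : k) (hζ : IsPrimitiveRoot ζ n)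
    (T : Type) [Ring T] [HopfAlgebra k T]
    (g x : T)
    (hg : IsGrouplike k g)
    (hx : Coalgebra.comul (R := k) x = g ⊗ₜ[k] x + x ⊗ₜ[k] (1 : T))
    (hgn : g ^ n = 1) (hxn : x ^ n = 0) (hgx : g * x = ζ • (x * g))
    (hgen : Algebra.adjoin k {g, x} = ⊤)
    (hdim : Module.finrank k T = n ^ 2) :
    -- `T(n)` is Galois-theoretical
    GaloisTheoretical k T ∧
    -- every inner faithful `T(n)`-module field has the stated form
    (∀ (L : Type) [Field L] [Algebra k L] (ha : HopfAction k T L),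
      InnerFaithful k ha.act.toLinearMap →
      ∃ (F : IntermediateField k L) (u : L),
        (F : Set L) = ha.invariants ∧
        u ≠ 0 ∧
        ha.act g u = ζ⁻¹ • u ∧
        ha.act x u = 1 ∧
        (∀ r ∈ F, ha.act g r = r ∧ ha.act x r = 0) ∧
        u ^ n ∈ F ∧
        (∀ n' : ℕ, 1 < n' → n' ∣ n → ¬∃ w ∈ F, w ^ n' = u ^ n) ∧
        Algebra.adjoin (↥F) {u} = ⊤ ∧
        IsGalois F L ∧ Module.finrank (↥F) L = n ∧
        Nonempty ((L ≃ₐ[F] L) ≃* Multiplicative (ZMod n))) ∧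
    -- conversely, every field `F ⊇ k` with such an element `v` arises this way
    (∀ (F : Type) [Field F] [Algebra k F] (v : F), v ≠ 0 →
      (∀ n' : ℕ, 1 < n' → n' ∣ n → ¬∃ f : F, f ^ n' = v) →
      Nonempty (TaftExtensionWitness k T g x n ζ F v)) := by
  refine ⟨?_, ?_, ?_⟩
  · obtain ⟨w⟩ := taft_converse hn hζ hg hx hgn hxn hgx hgen hdim (RatFunc k) RatFunc.X
      RatFunc.X_ne_zero (fun n' h1 _ => ratfunc_not_pow n' h1)
    letI := w.fieldL
    letI := w.algL
    exact ⟨{ L := w.L, action := w.action, faithful := w.faithful }⟩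
  · intro L _ _ ha hif
    exact taft_forward hn hζ hg hx hgn hxn hgx hgen hdim ha hif
  · intro F _ _ v hv h
    exact taft_converse hn hζ hg hx hgn hxn hgx hgen hdim F v hv h
end
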